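/- Let C be a tilted algebra with corresponding cluster-tilted algebra B = C ⋉ Ext^2_C(DC,C). If M is a τ_C-tilting C-module, then M is τ_B-tilting if and only if id_C M ≤ 1. -/

import Mathlib

open CategoryTheory MulOpposite

open CategoryTheory MulOpposite

/-! Core definitions: right `A`-modules are modules over `Aᵐᵒᵖ`. -/

/-- The category of (small) modules over a ring `R`.  For a `k`-algebra `A`,
right `A`-modules are `Mdl Aᵐᵒᵖ`. -/
abbrev Mdl (R : Type) [Ring R] := ModuleCat.{0} R

section Generic

variable (R : Type) [Ring R]

/-- `f : P → M` is a projective cover: `P` projective, `f` surjective with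
superfluous kernel. -/
def IsProjCover {P M : Mdl R} (f : P →ₗ[R] M) : Prop :=
  Module.Projective R P ∧ Function.Surjective f ∧
    ∀ N : Submodule R P, N ⊔ LinearMap.ker f = ⊤ → N = ⊤

/-- `f : M → I` is an injective envelope: `I` injective, `f` injective with
essential image. -/
def IsInjEnv {M I : Mdl R} (f : M →ₗ[R] I) : Prop :=
  Module.Injective R I ∧ Function.Injective f ∧
    ∀ K : Submodule R I, K ⊓ LinearMap.range f = ⊥ → K = ⊥

/-- `Hom_R(X, Y) = 0`. -/
def HomZero (X Y : Mdl R) : Prop := ∀ f : X →ₗ[R] Y, f = 0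

/-- `X ∈ Gen M`: `X` is an epimorphic image of a finite direct sum of copies of `M`. -/
def MemGen (M X : Mdl R) : Prop :=
  ∃ (d : ℕ) (f : (Fin d → M) →ₗ[R] X), Function.Surjective f

/-- `X ∈ add M`: `X` is a direct summand of a finite direct sum of copies of `M`. -/
def MemAdd (M X : Mdl R) : Prop :=
  ∃ (n : ℕ) (s : X →ₗ[R] (Fin n → M)) (r : (Fin n → M) →ₗ[R] X),
    r.comp s = LinearMap.id

/-- projective dimension at most 1: a length-one projective resolution exists. -/
def PdLE1 (M : Mdl R) : Prop :=
  ∃ (P1 P0 : Mdl R) (d1 : P1 →ₗ[R] P0) (d0 : P0 →ₗ[R] M),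
    Module.Projective R P1 ∧ Module.Projective R P0 ∧
    Function.Injective d1 ∧ Function.Surjective d0 ∧
    LinearMap.range d1 = LinearMap.ker d0

/-- projective dimension at most 2. -/
def PdLE2 (M : Mdl R) : Prop :=
  ∃ (P2 P1 P0 : Mdl R) (d2 : P2 →ₗ[R] P1) (d1 : P1 →ₗ[R] P0) (d0 : P0 →ₗ[R] M),
    Module.Projective R P2 ∧ Module.Projective R P1 ∧ Module.Projective R P0 ∧
    Function.Injective d2 ∧ Function.Surjective d0 ∧
    LinearMap.range d2 = LinearMap.ker d1 ∧ LinearMap.range d1 = LinearMap.ker d0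

/-- injective dimension at most 1. -/
def IdLE1 (M : Mdl R) : Prop :=
  ∃ (I0 I1 : Mdl R) (d0 : M →ₗ[R] I0) (d1 : I0 →ₗ[R] I1),
    Module.Injective R I0 ∧ Module.Injective R I1 ∧
    Function.Injective d0 ∧ Function.Surjective d1 ∧
    LinearMap.range d0 = LinearMap.ker d1

/-- global dimension at most 2 (every module has projective dimension ≤ 2). -/
def GlDimLE2 : Prop := ∀ M : Mdl R, PdLE2 R M

/-- global dimension exactly 2. -/
def GlDimEq2 : Prop := GlDimLE2 R ∧ ¬ ∀ M : Mdl R, PdLE1 R M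

/-- `W` is a first syzygy `Ω M` of `M` (kernel of a projective cover). -/
def IsSyzygy (M W : Mdl R) : Prop :=
  ∃ (P : Mdl R) (f : P →ₗ[R] M), IsProjCover R f ∧
    Nonempty (W ≃ₗ[R] LinearMap.ker f)

/-- `W` is a first cosyzygy `Ω⁻¹ M` of `M` (cokernel of an injective envelope). -/
def IsCosyzygy (M W : Mdl R) : Prop :=
  ∃ (I : Mdl R) (f : M →ₗ[R] I), IsInjEnv R f ∧
    Nonempty (W ≃ₗ[R] (I ⧸ LinearMap.range f))

/-- `P1 --d1--> P0 --d0--> M → 0` is a minimal projective presentation. -/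
def IsMinPres {P1 P0 M : Mdl R} (d1 : P1 →ₗ[R] P0) (d0 : P0 →ₗ[R] M) : Prop :=
  IsProjCover R d0 ∧ Module.Projective R P1 ∧
  LinearMap.range d1 = LinearMap.ker d0 ∧
  ∀ N : Submodule R P1, N ⊔ LinearMap.ker d1 = ⊤ → N = ⊤

/-- `Ext¹_R(X, Y) = 0`, expressed as: every short exact sequence
`0 → Y → Z → X → 0` splits. -/
def Ext1Zero (X Y : Mdl R) : Prop :=
  ∀ (Z : Mdl R) (i : Y →ₗ[R] Z) (p : Z →ₗ[R] X),
    Function.Injective i → Function.Surjective p →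
    LinearMap.range i = LinearMap.ker p →
    ∃ s : X →ₗ[R] Z, p.comp s = LinearMap.id

/-- partial tilting module: `pd ≤ 1` and `Ext¹(M,M) = 0`. -/
def PartialTilting (M : Mdl R) : Prop := PdLE1 R M ∧ Ext1Zero R M M

/-- tilting module: partial tilting plus a coresolution
`0 → R → T' → T'' → 0` with `T', T'' ∈ add M` of the regular module. -/
def IsTilting (M : Mdl R) : Prop :=
  PartialTilting R M ∧
  ∃ (T' T'' : Mdl R) (i : ModuleCat.of R R →ₗ[R] T') (p : T' →ₗ[R] T''),
    MemAdd R M T' ∧ MemAdd R M T'' ∧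
    Function.Injective i ∧ Function.Surjective p ∧
    LinearMap.range i = LinearMap.ker p

/-- an indecomposable (nonzero) module. -/
def Indecomp (M : Mdl R) : Prop :=
  Nontrivial M ∧ ∀ (U V : Submodule R M), IsCompl U V → U = ⊥ ∨ V = ⊥

/-- the number of isomorphism classes of simple `R`-modules is `n`. -/
def SimpleCount (n : ℕ) : Prop :=
  ∃ S : Fin n → Mdl R,
    (∀ i, IsSimpleModule R (S i)) ∧
    (∀ i j, Nonempty ((S i) ≃ₗ[R] (S j)) → i = j) ∧
    ∀ X : Mdl R, IsSimpleModule R X → ∃ i, Nonempty (X ≃ₗ[R] S i)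

end Generic

section Duality

variable (k : Type) [Field k] (A : Type) [Ring A] [Algebra k A]

/-- `N` (a right `A`-module) is the `k`-linear dual `D M` of the left `A`-module `M`:
witnessed by a nondegenerate balanced `k`-bilinear pairing. -/
def IskDual (N : Mdl Aᵐᵒᵖ) (M : Mdl A) : Prop :=
  ∃ φ : N → M → k,
    (∀ n n' m, φ (n + n') m = φ n m + φ n' m) ∧
    (∀ n m m', φ n (m + m') = φ n m + φ n m') ∧
    (∀ (c : k) n m, φ n ((algebraMap k A c) • m) = c * φ n m) ∧
    (∀ (a : A) n m, φ (op a • n) m = φ n (a • m)) ∧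
    (∀ n, (∀ m, φ n m = 0) → n = 0) ∧
    (∀ m, (∀ n, φ n m = 0) → m = 0)

/-- `T = τ M`: the Auslander–Reiten translate of the right `A`-module `M`,
i.e. the `k`-dual of the transpose `Tr M` computed from a minimal projective
presentation. -/
def IsTau (M T : Mdl Aᵐᵒᵖ) : Prop :=
  ∃ (P1 P0 : Mdl Aᵐᵒᵖ) (d1 : P1 →ₗ[Aᵐᵒᵖ] P0) (d0 : P0 →ₗ[Aᵐᵒᵖ] M),
    IsMinPres Aᵐᵒᵖ d1 d0 ∧
    ∃ (Tr : Mdl A) (q : (P1 →ₗ[Aᵐᵒᵖ] A) →ₗ[A] Tr),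
      Function.Surjective q ∧
      (∀ g : P1 →ₗ[Aᵐᵒᵖ] A, q g = 0 ↔ ∃ f : P0 →ₗ[Aᵐᵒᵖ] A, g = f.comp d1) ∧
      IskDual k A T Tr

/-- `T = τ⁻¹ M`: the inverse Auslander–Reiten translate, `Tr (D M)`, computed
from a minimal projective presentation of the left module `D M`. -/
def IsTauInv (M T : Mdl Aᵐᵒᵖ) : Prop :=
  ∃ (DM : Mdl A), IskDual k A M DM ∧
  ∃ (Q1 Q0 : Mdl A) (d1 : Q1 →ₗ[A] Q0) (d0 : Q0 →ₗ[A] DM),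
    IsMinPres A d1 d0 ∧
    ∃ q : (Q1 →ₗ[A] A) →ₗ[Aᵐᵒᵖ] T,
      Function.Surjective q ∧
      ∀ g : Q1 →ₗ[A] A, q g = 0 ↔ ∃ f : Q0 →ₗ[A] A, g = f.comp d1

/-- `W = τ⁻¹ Ω⁻¹ M`. -/
def IsTauInvCosyz (M W : Mdl Aᵐᵒᵖ) : Prop :=
  ∃ V, IsCosyzygy Aᵐᵒᵖ M V ∧ IsTauInv k A V W

/-- `W = τ Ω M`. -/
def IsTauSyz (M W : Mdl Aᵐᵒᵖ) : Prop :=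
  ∃ V, IsSyzygy Aᵐᵒᵖ M V ∧ IsTau k A V W

/-- `M` is `τ`-rigid: `Hom(M, τM) = 0`. -/
def TauRigid (M : Mdl Aᵐᵒᵖ) : Prop :=
  ∀ T, IsTau k A M T → HomZero Aᵐᵒᵖ M T

/-- `M` is `τ`-tilting: `τ`-rigid with as many pairwise nonisomorphic
indecomposable summands as there are simple modules. -/
def TauTilting (M : Mdl Aᵐᵒᵖ) : Prop :=
  TauRigid k A M ∧
  ∃ (n : ℕ) (N : Fin n → Mdl Aᵐᵒᵖ),
    (∀ i, Indecomp Aᵐᵒᵖ (N i)) ∧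
    (∀ i j, Nonempty ((N i) ≃ₗ[Aᵐᵒᵖ] (N j)) → i = j) ∧
    Nonempty (M ≃ₗ[Aᵐᵒᵖ] ((i : Fin n) → N i)) ∧
    SimpleCount Aᵐᵒᵖ n

end Duality


section SplitExt

variable {B C : Type} [Ring B] [Ring C]

/-- a right `C`-module viewed as a right `B`-module via a ring hom `π : B → C`. -/
def modAlong (π : B →+* C) (M : Mdl Cᵐᵒᵖ) : Mdl Bᵐᵒᵖ :=
  letI : Module Bᵐᵒᵖ M := Module.compHom M (RingHom.op π)
  ModuleCat.of _ M

/-- `X` is the induced module `M ⊗_C B` along `σ : C → B`, characterized by the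
universal property of induction (extension of scalars). -/
def IsInducedAlong (σ : C →+* B) (M : Mdl Cᵐᵒᵖ) (X : Mdl Bᵐᵒᵖ) : Prop :=
  ∃ φ : M →+ X,
    (∀ (c : C) (m : M), φ (op c • m) = op (σ c) • φ m) ∧
    ∀ (Y : Mdl Bᵐᵒᵖ) (ψ : M →+ Y),
      (∀ (c : C) (m : M), ψ (op c • m) = op (σ c) • ψ m) →
      ∃! h : X →ₗ[Bᵐᵒᵖ] Y, ∀ m, h (φ m) = ψ m

/-- `X` is the coinduced module `D(B ⊗_C D M) ≅ Hom_C(B, M)` along `σ : C → B`,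
characterized by the universal property of coinduction. -/
def IsCoinducedAlong (σ : C →+* B) (M : Mdl Cᵐᵒᵖ) (X : Mdl Bᵐᵒᵖ) : Prop :=
  ∃ p : X →+ M,
    (∀ (c : C) (x : X), p (op (σ c) • x) = op c • p x) ∧
    ∀ (Y : Mdl Bᵐᵒᵖ) (ψ : Y →+ M),
      (∀ (c : C) (y : Y), ψ (op (σ c) • y) = op c • ψ y) →
      ∃! h : Y →ₗ[Bᵐᵒᵖ] X, ∀ y, p (h y) = ψ y

end SplitExt

section TrivExt

variable (C : Type) [Ring C] (E : Type) [AddCommGroup E]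
  [Module C E] [Module Cᵐᵒᵖ E] [SMulCommClass C Cᵐᵒᵖ E]

/-- the projection `B = C ⋉ E → C` as a ring hom. -/
def tszeFst : TrivSqZeroExt C E →+* C where
  toFun := TrivSqZeroExt.fst
  map_one' := rfl
  map_mul' _ _ := rfl
  map_zero' := rfl
  map_add' _ _ := rfl

/-- the inclusion `σ : C → B = C ⋉ E` as a ring hom. -/
def tszeInl : C →+* TrivSqZeroExt C E where
  toFun := TrivSqZeroExt.inl
  map_one' := rfl
  map_mul' x y := TrivSqZeroExt.inl_mul (M := E) x y
  map_zero' := TrivSqZeroExt.inl_zero (M := E)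
  map_add' x y := TrivSqZeroExt.inl_add (M := E) x y

/-- a right `C`-module viewed as a module over the trivial extension `C ⋉ E`. -/
def modB (M : Mdl Cᵐᵒᵖ) : Mdl (TrivSqZeroExt C E)ᵐᵒᵖ :=
  modAlong (tszeFst C E) M

/-- `X = M ⊗_C B` for `B = C ⋉ E`. -/
def IsInduced (M : Mdl Cᵐᵒᵖ) (X : Mdl (TrivSqZeroExt C E)ᵐᵒᵖ) : Prop :=
  IsInducedAlong (tszeInl C E) M X

/-- `X = D(B ⊗_C D M)` for `B = C ⋉ E`. -/
def IsCoinduced (M : Mdl Cᵐᵒᵖ) (X : Mdl (TrivSqZeroExt C E)ᵐᵒᵖ) : Prop :=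
  IsCoinducedAlong (tszeInl C E) M X

end TrivExt

section RelExt

variable (k : Type) [Field k] (C : Type) [Ring C] [Algebra k C]
  (E : Type) [AddCommGroup E] [Module C E] [Module Cᵐᵒᵖ E]

/-- The `C`-`C`-bimodule `E` is `Ext²_C(DC, C)`: there is a projective
resolution `0 → P2 → P1 → P0 → DC → 0` of the right module `DC = Hom_k(C,k)`
(characterized by a nondegenerate balanced pairing `φ` with `C`), and `E` is
the cokernel of `Hom_C(P1, C) → Hom_C(P2, C)` as a left `C`-module, with the
right `C`-action on `E` induced (contravariantly, via lifts of the left action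
on `DC`) by functoriality of `Ext²(-, C)`. -/
def IsRelExt : Prop :=
  ∃ (DC : Mdl Cᵐᵒᵖ) (φ : DC → C → k),
    (∀ n n' m, φ (n + n') m = φ n m + φ n' m) ∧
    (∀ n m m', φ n (m + m') = φ n m + φ n m') ∧
    (∀ (c : k) n m, φ n ((algebraMap k C c) * m) = c * φ n m) ∧
    (∀ (a : C) n m, φ (op a • n) m = φ n (a * m)) ∧
    (∀ n, (∀ m, φ n m = 0) → n = 0) ∧
    (∀ m, (∀ n, φ n m = 0) → m = 0) ∧
    ∃ (P2 P1 P0 : Mdl Cᵐᵒᵖ) (d2 : P2 →ₗ[Cᵐᵒᵖ] P1) (d1 : P1 →ₗ[Cᵐᵒᵖ] P0)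
      (d0 : P0 →ₗ[Cᵐᵒᵖ] DC),
      Module.Projective Cᵐᵒᵖ P2 ∧ Module.Projective Cᵐᵒᵖ P1 ∧
      Module.Projective Cᵐᵒᵖ P0 ∧
      Function.Injective d2 ∧ Function.Surjective d0 ∧
      LinearMap.range d2 = LinearMap.ker d1 ∧
      LinearMap.range d1 = LinearMap.ker d0 ∧
      ∃ q : (P2 →ₗ[Cᵐᵒᵖ] C) →ₗ[C] E,
        Function.Surjective q ∧
        (∀ g : P2 →ₗ[Cᵐᵒᵖ] C, q g = 0 ↔ ∃ f : P1 →ₗ[Cᵐᵒᵖ] C, g = f.comp d2) ∧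
        ∀ c : C, ∃ (μ : DC →ₗ[Cᵐᵒᵖ] DC) (f0 : P0 →ₗ[Cᵐᵒᵖ] P0)
            (f1 : P1 →ₗ[Cᵐᵒᵖ] P1) (f2 : P2 →ₗ[Cᵐᵒᵖ] P2),
          (∀ n x, φ (μ n) x = φ n (x * c)) ∧
          d0.comp f0 = μ.comp d0 ∧
          d1.comp f1 = f0.comp d1 ∧
          d2.comp f2 = f1.comp d2 ∧
          ∀ g : P2 →ₗ[Cᵐᵒᵖ] C, q (g.comp f2) = op c • q g

end RelExt


section Aux1

variable {R : Type} [Ring R]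

/-- superfluous submodule -/
def Superfl {P : Type} [AddCommGroup P] [Module R P] (K : Submodule R P) : Prop :=
  ∀ N : Submodule R P, N ⊔ K = ⊤ → N = ⊤

theorem finite_of_superfl {P M : Type} [AddCommGroup P] [Module R P] [AddCommGroup M] [Module R M]
    (f : P →ₗ[R] M) (h : Superfl (LinearMap.ker f)) (hfg : (LinearMap.range f).FG) :
    Module.Finite R P := by
  classical
  obtain ⟨s, hs⟩ := hfg
  have hsub : (s : Set M) ⊆ f '' Set.univ := by
    intro x hx
    have : x ∈ LinearMap.range f := hs ▸ Submodule.subset_span hx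
    obtain ⟨y, rfl⟩ := this
    exact ⟨y, trivial, rfl⟩
  obtain ⟨t, -, ht⟩ := Finset.subset_set_image_iff.1 hsub
  have : Submodule.span R (t : Set P) = ⊤ := by
    apply h
    rw [eq_top_iff]
    intro x _
    have hx : f x ∈ Submodule.map f (Submodule.span R (t : Set P)) := by
      rw [Submodule.map_span, ← Finset.coe_image, ht, hs]
      exact ⟨x, rfl⟩
    obtain ⟨y, hy, hyx⟩ := hx
    have : x = y + (x - y) := by abel
    rw [this]
    apply Submodule.add_mem_sup hy
    simp [hyx]
  exact ⟨⟨t, this⟩⟩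

theorem superfl_iff_le_jacobson {P : Type} [AddCommGroup P] [Module R P] [Module.Finite R P]
    (K : Submodule R P) : Superfl K ↔ K ≤ Module.jacobson R P := by
  constructor
  · intro h
    refine le_sInf ?_
    intro N hN
    by_contra hK
    have h1 : N < N ⊔ K := by
      refine lt_of_le_of_ne le_sup_left ?_
      intro h2
      exact hK (h2 ▸ le_sup_right)
    have := h N (hN.2 _ h1)
    exact hN.1 this
  · intro h N hN
    by_contra hne
    obtain ⟨m, hm, hNm⟩ := (eq_top_or_exists_le_coatom N).resolve_left hne
    have : K ≤ m := h.trans (sInf_le hm)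
    exact hm.1 (top_le_iff.1 (hN ▸ sup_le hNm this))

theorem superfl_pi {ι : Type} [Finite ι] {P : ι → Type} [∀ i, AddCommGroup (P i)]
    [∀ i, Module R (P i)] [∀ i, Module.Finite R (P i)] (K : ∀ i, Submodule R (P i))
    (h : ∀ i, Superfl (K i)) (K' : Submodule R (∀ i, P i)) (hK' : ∀ x ∈ K', ∀ i, x i ∈ K i) :
    Superfl K' := by
  classical
  cases nonempty_fintype ι
  rw [superfl_iff_le_jacobson]
  intro x hx
  have : x = ∑ i, LinearMap.single R P i (x i) := by
    simpa using (LinearMap.sum_single_apply P x).symm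
  rw [this]
  refine Submodule.sum_mem _ fun i _ => ?_
  apply Module.map_jacobson_le (LinearMap.single R P i)
  exact ⟨x i, (superfl_iff_le_jacobson _).1 (h i) (hK' x hx i), rfl⟩

/-- Fitting, for endomorphisms -/
theorem exists_projCover [IsArtinianRing R] (M : Type) [AddCommGroup M] [Module R M]
    [Module.Finite R M] :
    ∃ (P : ModuleCat.{0} R) (f : P →ₗ[R] M), Module.Projective R P ∧ Module.Finite R P ∧
      Function.Surjective f ∧ Superfl (LinearMap.ker f) := by
  obtain ⟨n, f, hf⟩ := Module.Finite.exists_fin' R M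
  obtain ⟨Q, ⟨hQ, hQf⟩, hmin⟩ := IsArtinian.set_has_minimal
    {Q : Submodule R (Fin n → R) | Module.Projective R Q ∧ Submodule.map f Q = ⊤}
    ⟨⊤, Module.Projective.of_equiv (Submodule.topEquiv (R := R) (M := Fin n → R)).symm, by
      rw [Submodule.map_top, LinearMap.range_eq_top.2 hf]⟩
  have hsurj : Function.Surjective (f.comp Q.subtype) := by
    rw [← LinearMap.range_eq_top, LinearMap.range_comp, Submodule.range_subtype, hQf]
  refine ⟨ModuleCat.of R Q, f.comp Q.subtype, hQ, inferInstance, hsurj, ?_⟩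
  intro N hN
  change Submodule R Q at N
  have hNs : Function.Surjective ((f.comp Q.subtype).comp N.subtype) := by
    intro m
    obtain ⟨q, rfl⟩ := hsurj m
    have : (q : Q) ∈ N ⊔ LinearMap.ker (f.comp Q.subtype) := by rw [hN]; trivial
    obtain ⟨a, ha, b, hb, rfl⟩ := Submodule.mem_sup.1 this
    refine ⟨⟨a, ha⟩, ?_⟩
    have hb' : (f.comp Q.subtype) b = 0 := hb
    rw [map_add, hb', add_zero]
    rfl
  obtain ⟨g0, hg0⟩ := Module.projective_lifting_property _ (f.comp Q.subtype) hNs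
  let g : Module.End R Q := N.subtype.comp g0
  have hg : ∀ q, f (g q : Q) = f q := fun q => LinearMap.congr_fun hg0 q
  have hgn : ∀ (m : ℕ) (q : Q), f ((g ^ m) q : Q) = f q := by
    intro m
    induction m with
    | zero => intro q; rfl
    | succ m ih =>
      intro q
      rw [pow_succ', Module.End.mul_apply, hg, ih]
  obtain ⟨m, hm, hm1⟩ := ((LinearMap.eventually_isCompl_ker_pow_range_pow g).and
    (Filter.eventually_ge_atTop 1)).exists
  have hproj : Module.Projective R (LinearMap.range (g ^ m)) := by
    refine Module.Projective.of_split (LinearMap.range (g ^ m)).subtype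
      (Submodule.projectionOnto _ _ hm.symm) ?_
    refine LinearMap.ext fun x => ?_
    simp
  have heq : Submodule.map Q.subtype (LinearMap.range (g ^ m)) = Q := by
    by_contra hne
    refine hmin (Submodule.map Q.subtype (LinearMap.range (g ^ m))) ⟨?_, ?_⟩
      (lt_of_le_of_ne (Submodule.map_subtype_le _ _) hne)
    · exact Module.Projective.of_equiv (Submodule.equivMapOfInjective Q.subtype
        Q.injective_subtype (LinearMap.range (g ^ m)))
    · rw [eq_top_iff]
      intro x _
      obtain ⟨q, rfl⟩ := hsurj x
      exact ⟨_, ⟨_, ⟨q, rfl⟩, rfl⟩, hgn m q⟩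
  rw [eq_top_iff]
  intro q _
  have : (q : Fin n → R) ∈ Submodule.map Q.subtype (LinearMap.range (g ^ m)) := by
    rw [heq]; exact q.2
  obtain ⟨q', ⟨z, hz⟩, hq'⟩ := this
  have : q = g ((g ^ (m-1)) z) := by
    rw [← Module.End.mul_apply, ← pow_succ', Nat.sub_add_cancel hm1, hz]
    exact (Subtype.ext hq').symm
  rw [this]
  exact (g0 ((g ^ (m-1)) z)).2

theorem exists_minPres [IsArtinianRing R] (M : ModuleCat.{0} R) [Module.Finite R M] :
    ∃ (P1 P0 : ModuleCat.{0} R) (d1 : P1 →ₗ[R] P0) (d0 : P0 →ₗ[R] M),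
      IsMinPres R d1 d0 ∧ Module.Finite R P1 ∧ Module.Finite R P0 := by
  obtain ⟨P0, d0, hP0, hf0, hs0, hk0⟩ := exists_projCover (R := R) M
  obtain ⟨P1, f, hP1, hf1, hs1, hk1⟩ := exists_projCover (R := R) (LinearMap.ker d0)
  refine ⟨P1, P0, (LinearMap.ker d0).subtype.comp f, d0, ⟨⟨hP0, hs0, hk0⟩, hP1, ?_, ?_⟩, hf1, hf0⟩
  · rw [LinearMap.range_comp, LinearMap.range_eq_top.2 hs1, Submodule.map_top,
      Submodule.range_subtype]
  · have : LinearMap.ker ((LinearMap.ker d0).subtype.comp f) = LinearMap.ker f := by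
      rw [LinearMap.ker_comp, Submodule.ker_subtype]; rfl
    rw [this]; exact hk1

/-- every map out of `P1` extends along `d1`. -/
def Ext1Fac {P1 P0 : Type} [AddCommGroup P1] [Module R P1] [AddCommGroup P0] [Module R P0]
    (d1 : P1 →ₗ[R] P0) (N : Type) [AddCommGroup N] [Module R N] : Prop :=
  ∀ u : P1 →ₗ[R] N, ∃ h : P0 →ₗ[R] N, u = h.comp d1

theorem Ext1Fac.gen {P1 P0 : Type} [AddCommGroup P1] [Module R P1] [AddCommGroup P0] [Module R P0]
    [Module.Projective R P1]
    {d1 : P1 →ₗ[R] P0} {M : ModuleCat.{0} R} (h : Ext1Fac d1 M) {N : ModuleCat.{0} R}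
    (hN : MemGen R M N) : Ext1Fac d1 N := by
  intro u
  obtain ⟨d, f, hf⟩ := hN
  obtain ⟨v, hv⟩ := Module.projective_lifting_property f u hf
  choose w hw using fun i : Fin d => h ((LinearMap.proj i).comp v)
  refine ⟨f.comp (LinearMap.pi w), ?_⟩
  rw [← hv]
  ext x
  simp only [LinearMap.comp_apply]
  congr 1
  ext i
  exact LinearMap.congr_fun (hw i) x

/-- descend a map along a surjection. -/
theorem exists_descend {P M N : Type} [AddCommGroup P] [Module R P] [AddCommGroup M] [Module R M]
    [AddCommGroup N] [Module R N] (f : P →ₗ[R] M) (hf : Function.Surjective f) (g : P →ₗ[R] N)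
    (h : ∀ x, f x = 0 → g x = 0) : ∃ s : M →ₗ[R] N, ∀ x, s (f x) = g x := by
  let e := f.quotKerEquivOfSurjective hf
  refine ⟨((LinearMap.ker f).liftQ g (fun x hx => h x hx)).comp e.symm.toLinearMap, fun x => ?_⟩
  have : e.symm (f x) = (LinearMap.ker f).mkQ x := by
    rw [LinearEquiv.symm_apply_eq]
    rfl
  simp only [LinearMap.comp_apply, LinearEquiv.coe_coe, this]
  rfl

/-- factor a map through an injection. -/
theorem exists_factor {P M N : Type} [AddCommGroup P] [Module R P] [AddCommGroup M] [Module R M]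
    [AddCommGroup N] [Module R N] (i : N →ₗ[R] M) (hi : Function.Injective i) (g : P →ₗ[R] M)
    (h : ∀ x, g x ∈ LinearMap.range i) : ∃ s : P →ₗ[R] N, ∀ x, i (s x) = g x := by
  let e := LinearEquiv.ofInjective i hi
  refine ⟨e.symm.toLinearMap.comp (g.codRestrict _ h), fun x => ?_⟩
  have : e (e.symm (g.codRestrict _ h x)) = g.codRestrict _ h x := e.apply_symm_apply _
  exact congrArg Subtype.val this

/-- from the factorization property to lifting of maps out of `M`. -/
theorem lift_of_ext1Fac {P1 P0 M Z X N : Type} [AddCommGroup P1] [Module R P1] [AddCommGroup P0]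
    [Module R P0] [AddCommGroup M] [Module R M] [AddCommGroup Z] [Module R Z] [AddCommGroup X]
    [Module R X] [AddCommGroup N] [Module R N] [Module.Projective R P0]
    (d1 : P1 →ₗ[R] P0) (d0 : P0 →ₗ[R] M) (hd0 : Function.Surjective d0)
    (hd : LinearMap.range d1 = LinearMap.ker d0)
    (i : N →ₗ[R] Z) (p : Z →ₗ[R] X) (hi : Function.Injective i) (hp : Function.Surjective p)
    (hip : LinearMap.range i = LinearMap.ker p) (hN : Ext1Fac d1 N) (f : M →ₗ[R] X) :
    ∃ s : M →ₗ[R] Z, p.comp s = f := by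
  obtain ⟨g, hg⟩ := Module.projective_lifting_property p (f.comp d0) hp
  have hg' : ∀ x, p (g x) = f (d0 x) := fun x => LinearMap.congr_fun hg x
  have hd' : ∀ x, d0 (d1 x) = 0 := fun x => by
    have : d1 x ∈ LinearMap.ker d0 := hd ▸ ⟨x, rfl⟩
    exact this
  have hip' : ∀ x, p (i x) = 0 := fun x => by
    have : i x ∈ LinearMap.ker p := hip ▸ ⟨x, rfl⟩
    exact this
  obtain ⟨u, hu⟩ := exists_factor i hi (g.comp d1) (fun x => by
    rw [hip, LinearMap.mem_ker]
    simp [hg', hd'])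
  obtain ⟨h, hh⟩ := hN u
  obtain ⟨s, hs⟩ := exists_descend d0 hd0 (g - i.comp h) (fun x hx => by
    have : x ∈ LinearMap.range d1 := by rw [hd]; exact hx
    obtain ⟨y, rfl⟩ := this
    have h1 := hu y
    rw [hh] at h1
    simp only [LinearMap.comp_apply] at h1
    simp [h1])
  refine ⟨s, ?_⟩
  ext m
  obtain ⟨x, rfl⟩ := hd0 m
  simp [hs, hg', hip']

theorem ext1Zero_of_ext1Fac {M N : ModuleCat.{0} R} {P1 P0 : Type} [AddCommGroup P1] [Module R P1]
    [AddCommGroup P0] [Module R P0] [Module.Projective R P0]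
    (d1 : P1 →ₗ[R] P0) (d0 : P0 →ₗ[R] M) (hd0 : Function.Surjective d0)
    (hd : LinearMap.range d1 = LinearMap.ker d0) (hN : Ext1Fac d1 N) : Ext1Zero R M N := by
  intro Z i p hi hp hip
  exact lift_of_ext1Fac d1 d0 hd0 hd i p hi hp hip hN LinearMap.id

/-- `Ext1Zero` gives extension of maps from the kernel (pushout). -/
theorem extend_of_ext1Zero {M N : ModuleCat.{0} R} (h : Ext1Zero R M N) {P : Type} [AddCommGroup P]
    [Module R P] (d0 : P →ₗ[R] M) (hd0 : Function.Surjective d0)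
    (v : LinearMap.ker d0 →ₗ[R] N) : ∃ w : P →ₗ[R] N, ∀ x : LinearMap.ker d0, w x = v x := by
  let W : Submodule R (N × P) := LinearMap.range (LinearMap.prod (-v) (LinearMap.ker d0).subtype)
  let i : N →ₗ[R] ((N × P) ⧸ W) := W.mkQ.comp (LinearMap.inl R N P)
  let p : ((N × P) ⧸ W) →ₗ[R] M := W.liftQ (d0.comp (LinearMap.snd R N P)) (by
    rintro _ ⟨x, rfl⟩
    simp)
  have hi : Function.Injective i := by
    rw [injective_iff_map_eq_zero]
    intro n hn
    have : ((n, 0) : N × P) ∈ W := (Submodule.Quotient.mk_eq_zero W).1 hn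
    obtain ⟨x, hx⟩ := this
    have h2 : (x : P) = 0 := congrArg Prod.snd hx
    have h1 : - v x = n := congrArg Prod.fst hx
    have : x = 0 := Subtype.ext h2
    rw [← h1, this]; simp
  have hp : Function.Surjective p := by
    intro m
    obtain ⟨x, rfl⟩ := hd0 m
    exact ⟨W.mkQ (0, x), rfl⟩
  have hip : LinearMap.range i = LinearMap.ker p := by
    ext z
    obtain ⟨⟨n, x⟩, rfl⟩ := W.mkQ_surjective z
    constructor
    · rintro ⟨n', hn'⟩
      rw [← hn']
      change d0 0 = 0
      simp
    · intro hz
      have hx0 : d0 x = 0 := hz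
      refine ⟨n + v ⟨x, hx0⟩, ?_⟩
      change W.mkQ _ = W.mkQ _
      rw [← sub_eq_zero, ← map_sub, Submodule.mkQ_apply, Submodule.Quotient.mk_eq_zero]
      refine ⟨-⟨x, hx0⟩, ?_⟩
      simp
  obtain ⟨s, hs⟩ := h (ModuleCat.of R ((N × P) ⧸ W)) i p hi hp hip
  have hker : ∀ z, z - s (p z) ∈ LinearMap.range i := by
    intro z
    rw [hip, LinearMap.mem_ker, map_sub]
    have := LinearMap.congr_fun hs (p z)
    simp only [LinearMap.comp_apply, LinearMap.id_apply] at this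
    rw [this, sub_self]
  obtain ⟨r, hr⟩ := exists_factor i hi (LinearMap.id - s.comp p) hker
  refine ⟨r.comp (W.mkQ.comp (LinearMap.inr R N P)), fun x => ?_⟩
  apply hi
  simp only [LinearMap.comp_apply]
  rw [hr]
  have hpx : p (W.mkQ (LinearMap.inr R N P (x : P))) = 0 := x.2
  simp only [LinearMap.sub_apply, LinearMap.comp_apply, LinearMap.id_apply]
  rw [hpx, map_zero, sub_zero]
  change W.mkQ _ = W.mkQ _
  rw [← sub_eq_zero, ← map_sub, Submodule.mkQ_apply, Submodule.Quotient.mk_eq_zero]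
  refine ⟨x, ?_⟩
  simp

/-- Auslander–Smalø. -/
theorem ext1Fac_of_gen {M M' P1 P0 : ModuleCat.{0} R} (d1 : P1 →ₗ[R] P0) (d0 : P0 →ₗ[R] M)
    (hmin : IsMinPres R d1 d0) (h : ∀ N : ModuleCat.{0} R, MemGen R M' N → Ext1Zero R M N) :
    Ext1Fac d1 M' := by
  obtain ⟨⟨hP0, hd0, hk0⟩, hP1, hd, hk1⟩ := hmin
  intro u
  let U : Submodule R M' := Submodule.map u (LinearMap.ker d1)
  have hgen : MemGen R M' (ModuleCat.of R (M' ⧸ U)) := by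
    refine ⟨1, U.mkQ.comp (LinearMap.proj 0), ?_⟩
    exact U.mkQ_surjective.comp (LinearMap.proj_surjective (R := R) (φ := fun _ : Fin 1 => M') 0)
  -- the induced map K → M'/U
  obtain ⟨v, hv⟩ := exists_descend (d1.codRestrict (LinearMap.ker d0)
      (fun x => by rw [← hd]; exact ⟨x, rfl⟩)) (by
      rintro ⟨x, hx⟩
      have : x ∈ LinearMap.range d1 := by rw [hd]; exact hx
      obtain ⟨y, rfl⟩ := this
      exact ⟨y, rfl⟩) (U.mkQ.comp u) (fun x hx => by
      have : d1 x = 0 := congrArg Subtype.val hx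
      simp only [LinearMap.comp_apply, Submodule.mkQ_apply, Submodule.Quotient.mk_eq_zero]
      exact ⟨x, this, rfl⟩)
  obtain ⟨w, hw⟩ := extend_of_ext1Zero (h _ hgen) d0 hd0 v
  obtain ⟨g, hg⟩ := Module.projective_lifting_property U.mkQ w U.mkQ_surjective
  refine ⟨g, ?_⟩
  have key : ∀ x, (u - g.comp d1) x ∈ U := by
    intro x
    rw [← Submodule.Quotient.mk_eq_zero U, ← Submodule.mkQ_apply]
    simp only [LinearMap.sub_apply, LinearMap.comp_apply, map_sub]
    have h1 : U.mkQ (g (d1 x)) = w (d1 x) := LinearMap.congr_fun hg _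
    rw [h1, sub_eq_zero]
    have h2 := hv x
    have h3 := hw (d1.codRestrict (LinearMap.ker d0) (fun x => by rw [← hd]; exact ⟨x, rfl⟩) x)
    rw [h2] at h3
    exact h3.symm
  have : LinearMap.ker (u - g.comp d1) = ⊤ := by
    apply hk1
    rw [eq_top_iff]
    intro x _
    obtain ⟨y, hy, hyx⟩ := key x
    have hy' : d1 y = 0 := hy
    have : x = (x - y) + y := by abel
    rw [this]
    refine Submodule.add_mem_sup ?_ hy
    rw [LinearMap.mem_ker, map_sub, ← hyx]
    simp [hy']
  rw [LinearMap.ker_eq_top, sub_eq_zero] at this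
  exact this

end Aux1

section Aux2

open MulOpposite

/-- the regular module, as a linear map -/
def unopLin (A : Type) [Ring A] : Aᵐᵒᵖ →ₗ[Aᵐᵒᵖ] A where
  toFun x := unop x
  map_add' _ _ := rfl
  map_smul' a x := by simp

theorem exists_dualBasis {A : Type} [Ring A] (P : Type) [AddCommGroup P] [Module Aᵐᵒᵖ P]
    [Module.Finite Aᵐᵒᵖ P] [Module.Projective Aᵐᵒᵖ P] :
    ∃ (n : ℕ) (y : Fin n → P) (ys : Fin n → (P →ₗ[Aᵐᵒᵖ] A)),
      ∀ p, p = ∑ i, op (ys i p) • y i := by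
  classical
  obtain ⟨n, f, g, -, -, hfg⟩ := Module.Finite.exists_comp_eq_id_of_projective Aᵐᵒᵖ P
  refine ⟨n, fun i => f (Pi.single i 1), fun i => (unopLin A).comp ((LinearMap.proj i).comp g), ?_⟩
  intro p
  have h1 : f (g p) = p := LinearMap.congr_fun hfg p
  have h2 : g p = ∑ i, (g p i) • (Pi.single i 1 : Fin n → Aᵐᵒᵖ) := pi_eq_sum_univ' (g p)
  conv_lhs => rw [← h1, h2, map_sum]
  simp [unopLin]

/-- the map `p ↦ m * g p` -/
def smulHom {A : Type} [Ring A] {P M : Type} [AddCommGroup P] [Module Aᵐᵒᵖ P] [AddCommGroup M]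
    [Module Aᵐᵒᵖ M] (m : M) (g : P →ₗ[Aᵐᵒᵖ] A) : P →ₗ[Aᵐᵒᵖ] M where
  toFun p := op (g p) • m
  map_add' x y := by simp [add_smul]
  map_smul' a x := by
    simp only [map_smul, RingHom.id_apply]
    rw [← mul_smul]
    rfl

theorem smulHom_apply {A : Type} [Ring A] {P M : Type} [AddCommGroup P] [Module Aᵐᵒᵖ P]
    [AddCommGroup M] [Module Aᵐᵒᵖ M] (m : M) (g : P →ₗ[Aᵐᵒᵖ] A) (p : P) :
    smulHom m g p = op (g p) • m := rfl

theorem eq_sum_smulHom {A : Type} [Ring A] {P M : Type} [AddCommGroup P] [Module Aᵐᵒᵖ P]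
    [AddCommGroup M] [Module Aᵐᵒᵖ M] {n : ℕ} (y : Fin n → P) (ys : Fin n → (P →ₗ[Aᵐᵒᵖ] A))
    (hy : ∀ p, p = ∑ i, op (ys i p) • y i) (u : P →ₗ[Aᵐᵒᵖ] M) :
    u = ∑ i, smulHom (u (y i)) (ys i) := by
  ext p
  conv_lhs => rw [hy p]
  simp [smulHom_apply, LinearMap.sum_apply]

theorem eq_sum_smul_dual {A : Type} [Ring A] {P : Type} [AddCommGroup P] [Module Aᵐᵒᵖ P]
    {n : ℕ} (y : Fin n → P) (ys : Fin n → (P →ₗ[Aᵐᵒᵖ] A))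
    (hy : ∀ p, p = ∑ i, op (ys i p) • y i) (g : P →ₗ[Aᵐᵒᵖ] A) :
    g = ∑ i, g (y i) • ys i := by
  ext p
  conv_lhs => rw [hy p]
  simp [LinearMap.sum_apply]

/-- A balanced pairing on `M × Tr` which comes from a cokernel of finite projectives vanishes when
the maps from `P1` to `M` extend to `P0`.  -/
theorem balancedPairing_zero {A : Type} [Ring A] {P1 P0 M E V : Type} [AddCommGroup P1] [Module Aᵐᵒᵖ P1]
    [AddCommGroup P0] [Module Aᵐᵒᵖ P0]
    [Module.Finite Aᵐᵒᵖ P1] [Module.Projective Aᵐᵒᵖ P1]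
    [Module.Finite Aᵐᵒᵖ P0] [Module.Projective Aᵐᵒᵖ P0]
    [AddCommGroup M] [Module Aᵐᵒᵖ M] [AddCommGroup E] [Module A E] [AddCommGroup V]
    (d1 : P1 →ₗ[Aᵐᵒᵖ] P0) (q : (P1 →ₗ[Aᵐᵒᵖ] A) →ₗ[A] E) (hq : Function.Surjective q)
    (hq0 : ∀ f : P0 →ₗ[Aᵐᵒᵖ] A, q (f.comp d1) = 0) (hM : Ext1Fac d1 M)
    (β : M → E → V) (h1 : ∀ m m' e, β (m + m') e = β m e + β m' e)
    (h2 : ∀ m e e', β m (e + e') = β m e + β m e')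
    (h3 : ∀ m (a : A) e, β (op a • m) e = β m (a • e)) : ∀ m e, β m e = 0 := by
  have h1z : ∀ e, β 0 e = 0 := fun e => by simpa using h1 0 0 e
  have h2z : ∀ m, β m 0 = 0 := fun m => by simpa using h2 m 0 0
  let b1 : ∀ e, M →+ V := fun e => ⟨⟨fun m => β m e, h1z e⟩, fun m m' => h1 m m' e⟩
  let b2 : ∀ m, E →+ V := fun m => ⟨⟨fun e => β m e, h2z m⟩, fun e e' => h2 m e e'⟩
  have h1s : ∀ (n : ℕ) (x : Fin n → M) e, β (∑ i, x i) e = ∑ i, β (x i) e :=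
    fun n x e => map_sum (b1 e) _ _
  have h2s : ∀ (n : ℕ) (x : Fin n → E) m, β m (∑ i, x i) = ∑ i, β m (x i) :=
    fun n x m => map_sum (b2 m) _ _
  obtain ⟨n, y, ys, hy⟩ := exists_dualBasis (A := A) P1
  obtain ⟨n', x, xs, hx⟩ := exists_dualBasis (A := A) P0
  -- the functional
  let Ψ : (P1 →ₗ[Aᵐᵒᵖ] M) → V := fun u => ∑ i, β (u (y i)) (q (ys i))
  have hΨ : ∀ m g, Ψ (smulHom m g) = β m (q g) := by
    intro m g
    conv_rhs => rw [eq_sum_smul_dual y ys hy g, map_sum, h2s]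
    apply Finset.sum_congr rfl
    intro i _
    rw [smulHom_apply, h3, map_smul]
  intro m e
  obtain ⟨g, rfl⟩ := hq e
  rw [← hΨ]
  obtain ⟨h, hh⟩ := hM (smulHom m g)
  rw [hh]
  have h4 : h.comp d1 = ∑ i, smulHom (h (x i)) ((xs i).comp d1) := by
    conv_lhs => rw [eq_sum_smulHom x xs hx h]
    ext p
    simp [smulHom_apply, LinearMap.sum_apply]
  have h5 : Ψ (h.comp d1) = ∑ i, Ψ (smulHom (h (x i)) ((xs i).comp d1)) := by
    rw [h4]
    change ∑ j, β _ _ = ∑ i, ∑ j, β _ _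
    rw [Finset.sum_comm]
    apply Finset.sum_congr rfl
    intro j _
    rw [LinearMap.sum_apply, h1s]
  rw [h5]
  apply Finset.sum_eq_zero
  intro i _
  rw [hΨ, hq0, h2z]

variable (k : Type) [Field k] (A : Type) [Ring A] [Algebra k A] [FiniteDimensional k A]

theorem isArtinianRing_op (k : Type) [Field k] (A : Type) [Ring A] [Algebra k A]
    [FiniteDimensional k A] : IsArtinianRing Aᵐᵒᵖ := IsArtinianRing.of_finite k _

theorem tauRigid_of_gen (M : Mdl Aᵐᵒᵖ) [Module.Finite Aᵐᵒᵖ M]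
    (h : ∀ N : Mdl Aᵐᵒᵖ, MemGen Aᵐᵒᵖ M N → Ext1Zero Aᵐᵒᵖ M N) : TauRigid k A M := by
  have := isArtinianRing_op k A
  rintro T ⟨P1, P0, d1, d0, hmin, Tr, q, hq, hq0, φ, φ1, φ2, φ3, φ4, φ5, φ6⟩ f
  have hfac := ext1Fac_of_gen (M' := M) d1 d0 hmin h
  obtain ⟨⟨hP0, hd0, hk0⟩, hP1, hd, hk1⟩ := hmin
  have hf0 : Module.Finite Aᵐᵒᵖ P0 := finite_of_superfl d0 hk0 (IsNoetherian.noetherian _)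
  have hf1 : Module.Finite Aᵐᵒᵖ P1 := finite_of_superfl d1 hk1 (IsNoetherian.noetherian _)
  ext m
  apply φ5
  intro t
  exact balancedPairing_zero d1 q hq (fun f => (hq0 _).2 ⟨f, rfl⟩) hfac (fun m t => φ (f m) t)
    (fun m m' e => by simp [φ1]) (fun m e e' => φ2 _ _ _)
    (fun m a e => by simp [φ4]) m t

/-- the right module structure on the dual of a left module. -/
@[reducible] def dualModule (V : Type) [AddCommGroup V] [Module A V] [Module k V] [IsScalarTower k A V] :
    Module Aᵐᵒᵖ (V →ₗ[k] k) where
  smul a ψ := ψ.comp (Algebra.lsmul k k V a.unop)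
  one_smul ψ := by
    refine LinearMap.ext fun v => ?_
    change ψ ((1 : A) • v) = ψ v
    rw [one_smul]
  mul_smul a b ψ := by
    refine LinearMap.ext fun v => ?_
    change ψ ((b.unop * a.unop) • v) = ψ (b.unop • a.unop • v)
    rw [mul_smul]
  smul_zero a := by
    refine LinearMap.ext fun v => ?_
    rfl
  smul_add a ψ ψ' := by
    refine LinearMap.ext fun v => ?_
    rfl
  add_smul a b ψ := by
    refine LinearMap.ext fun v => ?_
    change ψ ((a.unop + b.unop) • v) = ψ (a.unop • v) + ψ (b.unop • v)
    rw [add_smul, map_add]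
  zero_smul ψ := by
    refine LinearMap.ext fun v => ?_
    change ψ ((0 : A) • v) = 0
    rw [zero_smul, map_zero]

theorem ext1Fac_of_tauRigid {M P1 P0 : Mdl Aᵐᵒᵖ} [Module.Finite Aᵐᵒᵖ P1]
    (d1 : P1 →ₗ[Aᵐᵒᵖ] P0) (d0 : P0 →ₗ[Aᵐᵒᵖ] M) (hmin : IsMinPres Aᵐᵒᵖ d1 d0)
    (h : TauRigid k A M) : Ext1Fac d1 M := by
  have hmin' := hmin
  obtain ⟨⟨hP0, hd0, hk0⟩, hP1, hd, hk1⟩ := hmin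
  let _ : Module k M := Module.compHom M (algebraMap k Aᵐᵒᵖ)
  have : IsScalarTower k Aᵐᵒᵖ M := ⟨fun c a m => by
    rw [Algebra.smul_def, mul_smul]; rfl⟩
  let W : Submodule A (P1 →ₗ[Aᵐᵒᵖ] A) :=
    { carrier := {g | ∃ f : P0 →ₗ[Aᵐᵒᵖ] A, g = f.comp d1}
      add_mem' := by
        rintro _ _ ⟨f, rfl⟩ ⟨f', rfl⟩
        exact ⟨f + f', rfl⟩
      zero_mem' := ⟨0, rfl⟩
      smul_mem' := by
        rintro a _ ⟨f, rfl⟩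
        exact ⟨a • f, rfl⟩ }
  let Tr : Mdl A := ModuleCat.of A ((P1 →ₗ[Aᵐᵒᵖ] A) ⧸ W)
  let _ : Module Aᵐᵒᵖ (((P1 →ₗ[Aᵐᵒᵖ] A) ⧸ W) →ₗ[k] k) := dualModule k A _
  let T : Mdl Aᵐᵒᵖ := ModuleCat.of Aᵐᵒᵖ (((P1 →ₗ[Aᵐᵒᵖ] A) ⧸ W) →ₗ[k] k)
  have hT : IsTau k A M T := by
    refine ⟨P1, P0, d1, d0, hmin', Tr, W.mkQ, W.mkQ_surjective, ?_, ?_⟩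
    · intro g
      rw [Submodule.mkQ_apply, Submodule.Quotient.mk_eq_zero]
      rfl
    · refine ⟨fun (ψ : ((P1 →ₗ[Aᵐᵒᵖ] A) ⧸ W) →ₗ[k] k) t => ψ t, fun _ _ _ => rfl,
        fun ψ _ _ => map_add ψ _ _, fun c ψ m => ?_, fun a ψ m => rfl, fun ψ hψ => ?_, fun m hm => ?_⟩
      · have : (algebraMap k A c) • m = c • m := algebraMap_smul A c m
        rw [this]
        exact map_smul ψ c m
      · exact LinearMap.ext hψ
      · exact (Module.forall_dual_apply_eq_zero_iff k m).1 hm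
  have hz := h T hT
  by_contra hfac
  simp only [Ext1Fac, not_forall] at hfac
  obtain ⟨u, hu⟩ := hfac
  let W' : Submodule k (P1 →ₗ[Aᵐᵒᵖ] M) :=
    { carrier := {g | ∃ f : P0 →ₗ[Aᵐᵒᵖ] M, g = f.comp d1}
      add_mem' := by
        rintro _ _ ⟨f, rfl⟩ ⟨f', rfl⟩
        exact ⟨f + f', rfl⟩
      zero_mem' := ⟨0, rfl⟩
      smul_mem' := by
        rintro a _ ⟨f, rfl⟩
        exact ⟨a • f, rfl⟩ }
  obtain ⟨l, hl, hlW⟩ := W'.exists_le_ker_of_notMem (v := u) hu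
  -- the map M → T
  let F : M → (((P1 →ₗ[Aᵐᵒᵖ] A) ⧸ W) →ₗ[k] k) := fun m =>
    (W.restrictScalars k).liftQ
      ({ toFun := fun g => l (smulHom m g)
         map_add' := fun g g' => by
          rw [← map_add]
          congr 1
          ext p
          simp [smulHom_apply, add_smul]
         map_smul' := fun c g => by
          rw [RingHom.id_apply, ← map_smul]
          congr 1
          ext p
          simp [smulHom_apply, smul_assoc] } : (P1 →ₗ[Aᵐᵒᵖ] A) →ₗ[k] k) (by
        rintro g ⟨f, rfl⟩
        exact hlW ⟨smulHom m f, rfl⟩)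
  have hF : ∀ m g, F m (W.mkQ g) = l (smulHom m g) := fun m g => rfl
  let F' : M →ₗ[Aᵐᵒᵖ] T :=
    { toFun := F
      map_add' := fun m m' => by
        refine LinearMap.ext fun t => ?_
        obtain ⟨g, rfl⟩ := W.mkQ_surjective t
        change F (m + m') (W.mkQ g) = F m (W.mkQ g) + F m' (W.mkQ g)
        rw [hF, hF, hF, ← map_add]
        congr 1
        ext p
        simp [smulHom_apply]
      map_smul' := fun a m => by
        refine LinearMap.ext fun t => ?_
        obtain ⟨g, rfl⟩ := W.mkQ_surjective t
        change F (a • m) (W.mkQ g) = F m (W.mkQ (a.unop • g))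
        rw [hF, hF]
        congr 1
        ext p
        simp [smulHom_apply, mul_smul] }
  have hF0 := hz F'
  have : ∀ m g, l (smulHom m g) = 0 := by
    intro m g
    rw [← hF]
    have : F m = 0 := LinearMap.congr_fun hF0 m
    rw [this]; rfl
  obtain ⟨n, y, ys, hy⟩ := exists_dualBasis (A := A) P1
  apply hl
  rw [eq_sum_smulHom y ys hy u, map_sum]
  exact Finset.sum_eq_zero fun i _ => this _ _

end Aux2

section Aux3

variable (k : Type) [Field k] (R : Type) [Ring R] [Algebra k R]

/-- the underlying `k`-module -/
@[reducible] def kMod (Q : Type) [AddCommGroup Q] [Module R Q] : Module k Q :=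
  Module.compHom Q (algebraMap k R)

theorem kMod_tower (Q : Type) [AddCommGroup Q] [Module R Q] :
    letI := kMod k R Q
    IsScalarTower k R Q :=
  letI := kMod k R Q
  ⟨fun c a m => by rw [Algebra.smul_def, mul_smul]; rfl⟩

theorem hom_finite (P Q : Type) [AddCommGroup P] [Module R P] [AddCommGroup Q] [Module R Q]
    [Module k Q] [IsScalarTower k R Q] [FiniteDimensional k R]
    [Module.Finite R P] [Module.Finite R Q] : Module.Finite k (P →ₗ[R] Q) := by
  let _ := kMod k R P
  have := kMod_tower k R P
  have : Module.Finite k Q := Module.Finite.trans R Q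
  have : Module.Finite k P := Module.Finite.trans R P
  exact Module.Finite.of_injective (LinearMap.restrictScalarsₗ k R P Q k)
    (LinearMap.restrictScalars_injective k)

/-- dimension of the space of homomorphisms -/
noncomputable def hd (P Q : Type) [AddCommGroup P] [Module R P] [AddCommGroup Q] [Module R Q] : ℕ :=
  letI := kMod k R Q
  haveI := kMod_tower k R Q
  Module.finrank k (P →ₗ[R] Q)

variable {P P1 P0 M Q Q' Q'' : Type} [AddCommGroup P] [Module R P] [AddCommGroup P1] [Module R P1]
  [AddCommGroup P0] [Module R P0] [AddCommGroup M] [Module R M] [AddCommGroup Q] [Module R Q]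
  [AddCommGroup Q'] [Module R Q'] [AddCommGroup Q''] [Module R Q'']

theorem hd_zero [Subsingleton Q] : hd k R P Q = 0 := by
  let _ := kMod k R Q
  have := kMod_tower k R Q
  have : Subsingleton (P →ₗ[R] Q) := ⟨fun f g => by ext x; exact Subsingleton.elim _ _⟩
  exact Module.finrank_zero_of_subsingleton

theorem hd_eq_zero_of (h : ∀ f : P →ₗ[R] Q, f = 0) : hd k R P Q = 0 := by
  let _ := kMod k R Q
  have := kMod_tower k R Q
  have : Subsingleton (P →ₗ[R] Q) := ⟨fun f g => by rw [h f, h g]⟩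
  exact Module.finrank_zero_of_subsingleton

variable [FiniteDimensional k R]

theorem hom_zero_of_hd [Module.Finite R P] [Module.Finite R Q] (h : hd k R P Q = 0)
    (f : P →ₗ[R] Q) : f = 0 := by
  let _ := kMod k R Q
  have := kMod_tower k R Q
  have := hom_finite k R P Q
  have : Subsingleton (P →ₗ[R] Q) := Module.finrank_zero_iff.1 h
  exact Subsingleton.elim _ _

theorem finrank_exact {V1 V2 V3 : Type} [AddCommGroup V1] [Module k V1] [AddCommGroup V2]
    [Module k V2] [AddCommGroup V3] [Module k V3] [Module.Finite k V2]
    (f : V1 →ₗ[k] V2) (g : V2 →ₗ[k] V3) (hf : Function.Injective f) (hg : Function.Surjective g)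
    (hfg : LinearMap.range f = LinearMap.ker g) :
    Module.finrank k V2 = Module.finrank k V1 + Module.finrank k V3 := by
  rw [← g.finrank_range_add_finrank_ker, ← hfg, LinearMap.finrank_range_of_inj hf,
    LinearMap.range_eq_top.2 hg, finrank_top, add_comm]

theorem hd_add [Module.Projective R P] [Module.Finite R P] [Module.Finite R Q]
    (i : Q' →ₗ[R] Q) (p : Q →ₗ[R] Q'') (hi : Function.Injective i) (hp : Function.Surjective p)
    (hip : LinearMap.range i = LinearMap.ker p) :
    hd k R P Q = hd k R P Q' + hd k R P Q'' := by
  let _ := kMod k R Q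
  have := kMod_tower k R Q
  let _ := kMod k R Q'
  have := kMod_tower k R Q'
  let _ := kMod k R Q''
  have := kMod_tower k R Q''
  have := hom_finite k R P Q
  have hip' : ∀ x, p (i x) = 0 := fun x => by
    have : i x ∈ LinearMap.ker p := hip ▸ ⟨x, rfl⟩
    exact this
  refine finrank_exact k
    ({ toFun := fun f => i.comp f
       map_add' := fun f g => by ext x; simp
       map_smul' := fun c f => by
        ext x
        exact (i.restrictScalars k).map_smul c (f x) } : (P →ₗ[R] Q') →ₗ[k] (P →ₗ[R] Q))
    ({ toFun := fun f => p.comp f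
       map_add' := fun f g => by ext x; simp
       map_smul' := fun c f => by
        ext x
        exact (p.restrictScalars k).map_smul c (f x) } : (P →ₗ[R] Q) →ₗ[k] (P →ₗ[R] Q''))
    ?_ ?_ ?_
  · intro f g hfg
    ext x
    exact hi (LinearMap.congr_fun hfg x)
  · intro f
    obtain ⟨g, hg⟩ := Module.projective_lifting_property p f hp
    exact ⟨g, hg⟩
  · ext f
    constructor
    · rintro ⟨g, rfl⟩
      ext x
      exact hip' _
    · intro hf
      obtain ⟨g, hg⟩ := exists_factor i hi f (fun x => by
        rw [hip]
        exact LinearMap.congr_fun hf x)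
      refine ⟨g, ?_⟩
      ext x
      exact hg x

theorem hd_congr [Module.Projective R P] [Module.Finite R P] [Module.Finite R Q] (e : Q' ≃ₗ[R] Q) :
    hd k R P Q = hd k R P Q' := by
  rw [hd_add k R (Q'' := PUnit) e.toLinearMap 0 e.injective (fun x => ⟨0, Subsingleton.elim _ _⟩)
    (by rw [LinearEquiv.range, LinearMap.ker_zero]), hd_zero k R (Q := PUnit), add_zero]

theorem hd_pres [Module.Finite R P0] [Module.Finite R Q]
    (d1 : P1 →ₗ[R] P0) (d0 : P0 →ₗ[R] M) (hd0 : Function.Surjective d0)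
    (hdd : LinearMap.range d1 = LinearMap.ker d0) (hN : Ext1Fac d1 Q) :
    hd k R P0 Q = hd k R M Q + hd k R P1 Q := by
  let _ := kMod k R Q
  have := kMod_tower k R Q
  have := hom_finite k R P0 Q
  have hdd' : ∀ x, d0 (d1 x) = 0 := fun x => by
    have : d1 x ∈ LinearMap.ker d0 := hdd ▸ ⟨x, rfl⟩
    exact this
  refine finrank_exact k
    ({ toFun := fun f => f.comp d0
       map_add' := fun f g => by ext x; simp
       map_smul' := fun c f => by ext x; simp } : (M →ₗ[R] Q) →ₗ[k] (P0 →ₗ[R] Q))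
    ({ toFun := fun f => f.comp d1
       map_add' := fun f g => by ext x; simp
       map_smul' := fun c f => by ext x; simp } : (P0 →ₗ[R] Q) →ₗ[k] (P1 →ₗ[R] Q))
    ?_ ?_ ?_
  · intro f g hfg
    ext x
    obtain ⟨y, rfl⟩ := hd0 x
    exact LinearMap.congr_fun hfg y
  · intro f
    obtain ⟨h, rfl⟩ := hN f
    exact ⟨h, rfl⟩
  · ext f
    constructor
    · rintro ⟨g, rfl⟩
      ext x
      simp [hdd']
    · intro hf
      obtain ⟨g, hg⟩ := exists_descend d0 hd0 f (fun x hx => by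
        have : x ∈ LinearMap.range d1 := by rw [hdd]; exact hx
        obtain ⟨y, rfl⟩ := this
        exact LinearMap.congr_fun hf y)
      refine ⟨g, ?_⟩
      ext x
      exact hg x

end Aux3

section NoS

variable {R : Type} [Ring R]

/-- `S` does not map nontrivially to any quotient of `Q`. -/
def NoS (S Q : Type) [AddCommGroup S] [Module R S] [AddCommGroup Q] [Module R Q] : Prop :=
  ∀ (W : ModuleCat.{0} R) (π : Q →ₗ[R] W), Function.Surjective π → ∀ f : S →ₗ[R] W, f = 0

variable {S Q Q' Q'' : Type} [AddCommGroup S] [Module R S] [AddCommGroup Q] [Module R Q]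
  [AddCommGroup Q'] [Module R Q'] [AddCommGroup Q''] [Module R Q'']

theorem NoS.quot (h : NoS (R := R) S Q) (p : Q →ₗ[R] Q') (hp : Function.Surjective p) :
    NoS (R := R) S Q' := fun W π hπ f => h W (π.comp p) (hπ.comp hp) f

theorem NoS.sub (h : NoS (R := R) S Q) (i : Q' →ₗ[R] Q) (hi : Function.Injective i) :
    NoS (R := R) S Q' := by
  intro W π hπ f
  -- W ≅ Q'/ker π ↪ Q / i(ker π)
  let U := Submodule.map i (LinearMap.ker π)
  obtain ⟨s, hs⟩ := exists_descend π hπ (U.mkQ.comp i) (fun x hx => by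
    simp only [LinearMap.comp_apply, Submodule.mkQ_apply, Submodule.Quotient.mk_eq_zero]
    exact ⟨x, hx, rfl⟩)
  have h0 := h (ModuleCat.of R (Q ⧸ U)) U.mkQ U.mkQ_surjective (s.comp f)
  ext x
  obtain ⟨y, hy⟩ := hπ (f x)
  have h1 : s (f x) = 0 := LinearMap.congr_fun h0 x
  rw [← hy, hs] at h1
  simp only [LinearMap.comp_apply, Submodule.mkQ_apply, Submodule.Quotient.mk_eq_zero] at h1
  obtain ⟨z, hz, hzy⟩ := h1
  rw [← hy, ← hi hzy]
  exact hz

theorem NoS.ext (i : Q' →ₗ[R] Q) (p : Q →ₗ[R] Q'') (hp : Function.Surjective p)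
    (hip : LinearMap.ker p ≤ LinearMap.range i) (h' : NoS (R := R) S Q') (h'' : NoS (R := R) S Q'') :
    NoS (R := R) S Q := by
  intro W π hπ f
  let W' : Submodule R W := LinearMap.range (π.comp i)
  obtain ⟨s, hs⟩ := exists_descend p hp (W'.mkQ.comp π) (fun x hx => by
    simp only [LinearMap.comp_apply, Submodule.mkQ_apply, Submodule.Quotient.mk_eq_zero]
    obtain ⟨y, rfl⟩ := hip hx
    exact ⟨y, rfl⟩)
  have hsurj : Function.Surjective s := by
    intro w
    obtain ⟨w, rfl⟩ := W'.mkQ_surjective w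
    obtain ⟨x, rfl⟩ := hπ w
    exact ⟨p x, hs x⟩
  have h0 := h'' (ModuleCat.of R (W ⧸ W')) s hsurj (W'.mkQ.comp f)
  have hf : ∀ x, f x ∈ W' := fun x => by
    have := LinearMap.congr_fun h0 x
    simpa using this
  have h1 := h' (ModuleCat.of R W') (π.comp i).rangeRestrict (LinearMap.surjective_rangeRestrict _)
    (f.codRestrict W' hf)
  ext x
  exact congrArg Subtype.val (LinearMap.congr_fun h1 x)

theorem NoS.pi (h : NoS (R := R) S Q) (d : ℕ) : NoS (R := R) S (Fin d → Q) := by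
  induction d with
  | zero =>
    intro W π hπ f
    ext x
    obtain ⟨y, hy⟩ := hπ (f x)
    have : y = 0 := Subsingleton.elim _ _
    rw [← hy, this, map_zero]
    rfl
  | succ d ih =>
    refine NoS.ext (LinearMap.single R (fun _ : Fin (d+1) => Q) 0)
      (LinearMap.funLeft R Q Fin.succ) ?_ ?_ h ih
    · exact LinearMap.funLeft_surjective_of_injective R Q _ (Fin.succ_injective d)
    · intro x hx
      refine ⟨x 0, ?_⟩
      ext j
      refine Fin.cases ?_ (fun j => ?_) j
      · simp
      · have : x j.succ = 0 := congrFun (show LinearMap.funLeft R Q Fin.succ x = 0 from hx) j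
        simp [this]

end NoS

section Krull

variable {R : Type} [Ring R]

theorem one_mem_ideal_pow {Γ : Type} [Ring Γ] (J : Ideal Γ) : (1 : Γ) ∈ J ^ 0 := by
  rw [Submodule.pow_zero, Ideal.one_eq_top]; trivial

theorem mul_mem_ideal_pow {Γ : Type} [Ring Γ] (J : Ideal Γ) [J.IsTwoSided] {m : ℕ} {a b : Γ} (ha : a ∈ J)
    (hb : b ∈ J ^ m) : a * b ∈ J ^ (m + 1) := by
  by_cases hm : m = 0
  · subst hm
    rw [zero_add, Submodule.pow_one]
    exact J.mul_mem_right _ ha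
  · rw [Submodule.pow_succ' _ hm]; exact Ideal.mul_mem_mul ha hb

theorem nilp_or_bij (N : ModuleCat.{0} R) [IsArtinian R N] [IsNoetherian R N]
    (hN : Indecomp R N) (w : Module.End R N) : IsNilpotent w ∨ Function.Bijective w := by
  obtain ⟨n, hn1, hn⟩ := ((Filter.eventually_ge_atTop 1).and
    (LinearMap.eventually_isCompl_ker_pow_range_pow w)).exists
  rcases hN.2 _ _ hn with h | h
  · right
    rw [h] at hn
    have htop : LinearMap.range (w ^ n) = ⊤ := by simpa using hn.sup_eq_top
    obtain ⟨m, rfl⟩ : ∃ m, n = m + 1 := ⟨n - 1, by omega⟩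
    constructor
    · rw [← LinearMap.ker_eq_bot, eq_bot_iff]
      intro x hx
      have hx' : w x = 0 := hx
      rw [← h, LinearMap.mem_ker, pow_succ, Module.End.mul_apply, hx', map_zero]
    · intro y
      obtain ⟨x, hx⟩ := LinearMap.range_eq_top.1 htop y
      rw [pow_succ', Module.End.mul_apply] at hx
      exact ⟨_, hx⟩
  · left
    exact ⟨n, LinearMap.range_eq_bot.1 h⟩

theorem iso_of_bij (N N' : ModuleCat.{0} R) (hN : Indecomp R N) (hN' : Indecomp R N')
    (a : N →ₗ[R] N') (b : N' →ₗ[R] N) (h : Function.Bijective (b.comp a)) :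
    Nonempty (N' ≃ₗ[R] N) := by
  have hc : IsCompl (LinearMap.range a) (LinearMap.ker b) := by
    constructor
    · rw [Submodule.disjoint_def]
      rintro _ ⟨y, rfl⟩ hy
      have : (b.comp a) y = (b.comp a) 0 := by rw [map_zero]; exact hy
      rw [h.1 this, map_zero]
    · rw [codisjoint_iff, eq_top_iff]
      intro x _
      obtain ⟨y, hy⟩ := h.2 (b x)
      refine Submodule.mem_sup.2 ⟨a y, ⟨y, rfl⟩, x - a y, ?_, by abel⟩
      rw [LinearMap.mem_ker, map_sub, ← hy]
      exact sub_self _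
  rcases hN'.2 _ _ hc with h0 | h0
  · exfalso
    obtain ⟨x, hx⟩ := @exists_ne _ hN.1 (0 : N)
    apply hx
    apply h.1
    have : a = 0 := LinearMap.range_eq_bot.1 h0
    simp [this]
  · exact ⟨LinearEquiv.ofBijective b ⟨LinearMap.ker_eq_bot.1 h0, fun y => by
      obtain ⟨x, hx⟩ := h.2 y
      exact ⟨a x, hx⟩⟩⟩

theorem nilp_swap {V W : Type} [AddCommGroup V] [Module R V] [AddCommGroup W] [Module R W]
    (X : V →ₗ[R] W) (Y : W →ₗ[R] V) (h : IsNilpotent (X.comp Y : Module.End R W)) :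
    IsNilpotent (Y.comp X : Module.End R V) := by
  obtain ⟨m, hm⟩ := h
  refine ⟨m + 1, ?_⟩
  have : ∀ m, ((Y.comp X : Module.End R V) ^ (m + 1)) =
      Y.comp (((X.comp Y : Module.End R W) ^ m).comp X) := by
    intro m
    induction m with
    | zero => rfl
    | succ m ih => rw [pow_succ', ih, pow_succ' (X.comp Y : Module.End R W)]; rfl
  rw [this, hm]
  simp

theorem rad_mem {n : ℕ} (N : Fin n → ModuleCat.{0} R) [∀ i, IsArtinian R (N i)]
    [∀ i, IsNoetherian R (N i)] (hN : ∀ i, Indecomp R (N i))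
    (hiso : ∀ i j, Nonempty ((N i) ≃ₗ[R] (N j)) → i = j) (i j : Fin n) (hij : i ≠ j)
    (u : N j →ₗ[R] N i) :
    ((LinearMap.single R (fun i => N i) i).comp (u.comp (LinearMap.proj j)) :
      Module.End R ((i : Fin n) → N i)) ∈ Ring.jacobson (Module.End R ((i : Fin n) → N i)) := by
  rw [← Ideal.jacobson_bot, Ideal.mem_jacobson_iff]
  intro y
  have hnil : IsNilpotent (y * ((LinearMap.single R (fun i => N i) i).comp
      (u.comp (LinearMap.proj j)) : Module.End R ((i : Fin n) → N i))) := by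
    refine nilp_swap (LinearMap.proj j : ((i : Fin n) → N i) →ₗ[R] N j)
      (y.comp ((LinearMap.single R (fun i => N i) i).comp u)) ?_
    rcases nilp_or_bij (N j) (hN j) ((LinearMap.proj j : ((i : Fin n) → N i) →ₗ[R] N j).comp
      (y.comp ((LinearMap.single R (fun i => N i) i).comp u))) with h | h
    · exact h
    · exact absurd (hiso _ _ (iso_of_bij (N j) (N i) (hN j) (hN i) u
        ((LinearMap.proj j : ((i : Fin n) → N i) →ₗ[R] N j).comp
          (y.comp (LinearMap.single R (fun i => N i) i))) h)) hij
  obtain ⟨z, hz⟩ := hnil.isUnit_one_add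
  refine ⟨(z⁻¹ : _), ?_⟩
  have : (z⁻¹ : _).1 * z.1 = 1 := z.inv_mul
  rw [hz, mul_add, mul_one, ← mul_assoc] at this
  rw [Ideal.mem_bot, ← this]
  abel

/-- no nontrivial family of indecomposables generated by each other through radical maps -/
theorem radical_gen_empty {n : ℕ} (N : Fin n → ModuleCat.{0} R) [∀ i, IsArtinian R (N i)]
    [∀ i, IsNoetherian R (N i)] (hN : ∀ i, Indecomp R (N i))
    (hiso : ∀ i j, Nonempty ((N i) ≃ₗ[R] (N j)) → i = j)
    [IsArtinianRing (Module.End R ((i : Fin n) → N i))]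
    (supp : Fin n → Prop) (rel : Fin n → Fin n → Prop) (hrel : ∀ i j, rel i j → i ≠ j)
    (h : ∀ i, supp i → (⨆ x : (Σ j : {j // supp j ∧ rel i j}, (N j.1 →ₗ[R] N i)),
      LinearMap.range x.2) = ⊤) (i : Fin n) (hi : supp i) : False := by
  obtain ⟨m, hm⟩ := IsSemiprimaryRing.isNilpotent (R := Module.End R ((i : Fin n) → N i))
  let J := Ring.jacobson (Module.End R ((i : Fin n) → N i))
  have key : ∀ m, ∀ i, supp i → ∀ x : N i, LinearMap.single R (fun i => N i) i x ∈
      ⨆ φ : {φ : Module.End R ((i : Fin n) → N i) // φ ∈ J ^ m}, LinearMap.range φ.1 := by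
    intro m
    induction m with
    | zero =>
      intro i hi x
      refine Submodule.mem_iSup_of_mem ⟨1, one_mem_ideal_pow J⟩ ⟨_, rfl⟩
    | succ m ih =>
      intro i hi x
      have hx : x ∈ ⨆ x : (Σ j : {j // supp j ∧ rel i j}, (N j.1 →ₗ[R] N i)),
        LinearMap.range x.2 := by rw [h i hi]; trivial
      induction hx using Submodule.iSup_induction' with
      | mem f x hx =>
        obtain ⟨⟨j, hj, hr⟩, f⟩ := f
        obtain ⟨y, rfl⟩ := hx
        have h1 := ih j hj y
        let Φ : Module.End R ((i : Fin n) → N i) :=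
          (LinearMap.single R (fun i => N i) i).comp (f.comp (LinearMap.proj j))
        have hΦ : Φ ∈ J := rad_mem N hN hiso i j (hrel _ _ hr) f
        have h2 : Φ (LinearMap.single R (fun i => N i) j y) ∈ Submodule.map Φ _ :=
          Submodule.mem_map_of_mem h1
        have h3 : Φ (LinearMap.single R (fun i => N i) j y) =
            LinearMap.single R (fun i => N i) i (f y) := by
          simp [Φ]
        rw [h3, Submodule.map_iSup] at h2
        revert h2
        apply SetLike.le_def.1
        refine iSup_le fun φ => ?_
        refine le_trans ?_ (le_iSup _ (⟨Φ * φ.1, mul_mem_ideal_pow J hΦ φ.2⟩ :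
            {φ : Module.End R ((i : Fin n) → N i) // φ ∈ J ^ (m+1)}))
        rintro _ ⟨_, ⟨z, rfl⟩, rfl⟩
        exact ⟨z, rfl⟩
      | zero => rw [map_zero]; exact Submodule.zero_mem _
      | add x y _ _ h1 h2 => rw [map_add]; exact Submodule.add_mem _ h1 h2
  obtain ⟨x, hx⟩ := @exists_ne _ (hN i).1 (0 : N i)
  apply hx
  have := key m i hi x
  have h0 : (⨆ φ : {φ : Module.End R ((i : Fin n) → N i) // φ ∈ J ^ m}, LinearMap.range φ.1) = ⊥ := by
    rw [eq_bot_iff]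
    refine iSup_le fun φ => ?_
    have : φ.1 = 0 := by
      have h1 : ∀ ψ ∈ J ^ m, ψ = 0 := by
        intro ψ hψ
        rw [show J ^ m = 0 from hm] at hψ
        exact hψ
      exact h1 _ φ.2
    rw [this, LinearMap.range_zero]
  rw [h0, Submodule.mem_bot] at this
  have := congrFun this i
  simpa using this

end Krull

section Sincere

theorem memGen_iSup {R : Type} [Ring R] {M : ModuleCat.{0} R} {N : Type} [AddCommGroup N]
    [Module R N] [IsNoetherian R N] {κ : Type} (g : κ → (M →ₗ[R] N)) :
    MemGen R M (ModuleCat.of R (⨆ x, LinearMap.range (g x) : Submodule R N)) := by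
  classical
  set t : Submodule R N := ⨆ x, LinearMap.range (g x) with ht
  have hc : IsCompactElement t := (Submodule.fg_iff_compact t).1 (IsNoetherian.noetherian t)
  obtain ⟨s, hs⟩ := CompleteLattice.IsCompactElement.exists_finset_of_le_iSup _ hc _ ht.le
  let e := s.equivFin.symm
  let G : (Fin s.card → M) →ₗ[R] N := ∑ l, (g (e l).1).comp (LinearMap.proj l)
  have hG : ∀ y, G y ∈ t := fun y => by
    simp only [G, LinearMap.sum_apply, LinearMap.comp_apply]
    refine Submodule.sum_mem _ fun l _ => ?_
    rw [ht]
    exact Submodule.mem_iSup_of_mem (e l).1 ⟨_, rfl⟩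
  have hr : t ≤ LinearMap.range G := by
    refine hs.trans (iSup₂_le fun x hx => ?_)
    rintro _ ⟨m, rfl⟩
    refine ⟨Pi.single (s.equivFin ⟨x, hx⟩) m, ?_⟩
    simp only [G, LinearMap.sum_apply, LinearMap.comp_apply, LinearMap.proj_apply]
    rw [Finset.sum_eq_single (s.equivFin ⟨x, hx⟩)]
    · simp [e]
    · intro b _ hb
      rw [Pi.single_eq_of_ne hb, map_zero]
    · intro h; exact absurd (Finset.mem_univ _) h
  refine ⟨s.card, G.codRestrict t hG, ?_⟩
  rintro ⟨x, hx⟩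
  obtain ⟨y, hy⟩ := hr hx
  exact ⟨y, Subtype.ext hy⟩

variable (k : Type) [Field k] {R : Type} [Ring R] [Algebra k R] [FiniteDimensional k R]

theorem top_of_sum_zero {n : ℕ} (N P1 P0 : Fin n → ModuleCat.{0} R)
    [∀ i, Module.Finite R (N i)] [∀ i, Module.Projective R (P0 i)]
    (d1 : ∀ i, P1 i →ₗ[R] P0 i) (d0 : ∀ i, P0 i →ₗ[R] N i)
    (hd0 : ∀ i, Function.Surjective (d0 i))
    (hdd : ∀ i, LinearMap.range (d1 i) = LinearMap.ker (d0 i))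
    (M : ModuleCat.{0} R) (e : M ≃ₗ[R] ((i : Fin n) → N i))
    (hfac : ∀ i, ∀ W : ModuleCat.{0} R, MemGen R M W → Ext1Fac (d1 i) W)
    (a : Fin n → ℚ)
    (ha : ∀ W : ModuleCat.{0} R, MemGen R M W → ∑ i, a i * (hd k R (N i) W : ℚ) = 0)
    (i : Fin n) (hi : a i ≠ 0) :
    (⨆ x : (Σ j : {j // a j ≠ 0 ∧ a i * a j < 0}, (N j.1 →ₗ[R] N i)), LinearMap.range x.2) = ⊤ := by
  have : IsArtinianRing R := IsArtinianRing.of_finite k R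
  let pr : ∀ j, M →ₗ[R] N j := fun j => (LinearMap.proj j).comp e.toLinearMap
  have hpr : ∀ j, Function.Surjective (pr j) := fun j x => by
    refine ⟨e.symm (Pi.single j x), ?_⟩
    simp [pr]
  let g : (Σ j : {j // a j ≠ 0 ∧ a i * a j < 0}, (N j.1 →ₗ[R] N i)) → (M →ₗ[R] N i) :=
    fun x => x.2.comp (pr x.1.1)
  have hg : ∀ x, LinearMap.range (g x) = LinearMap.range x.2 := fun x => by
    rw [LinearMap.range_comp, LinearMap.range_eq_top.2 (hpr _), Submodule.map_top]
  simp_rw [← hg]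
  have htG := memGen_iSup g
  set t : Submodule R (N i) := ⨆ x, LinearMap.range (g x) with ht
  have hW : MemGen R M (ModuleCat.of R (N i ⧸ t)) := by
    refine ⟨1, t.mkQ.comp ((pr i).comp (LinearMap.proj 0)), ?_⟩
    refine t.mkQ_surjective.comp ((hpr i).comp ?_)
    intro x; exact ⟨fun _ => x, rfl⟩
  have hsum := ha _ hW
  have hsum' : ∑ j, (a i * a j) * (hd k R (N j) (N i ⧸ t) : ℚ) = 0 := by
    have : ∑ j, (a i * a j) * (hd k R (N j) (N i ⧸ t) : ℚ)
      = a i * ∑ j, a j * (hd k R (N j) (N i ⧸ t) : ℚ) := by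
      rw [Finset.mul_sum]; simp_rw [mul_assoc]
    rw [this, show ∑ j, a j * (hd k R (N j) (N i ⧸ t) : ℚ) = 0 from hsum, mul_zero]
  have hz : ∀ j, a i * a j < 0 → hd k R (N j) (N i ⧸ t) = 0 := by
    intro j hj
    apply hd_eq_zero_of
    intro f
    obtain ⟨s, hs⟩ := lift_of_ext1Fac (d1 j) (d0 j) (hd0 j) (hdd j) t.subtype t.mkQ
      t.injective_subtype t.mkQ_surjective (by simp) (hfac j _ htG) f
    have hle : LinearMap.range s ≤ t := by
      let x : (Σ j : {j // a j ≠ 0 ∧ a i * a j < 0}, (N j.1 →ₗ[R] N i)) :=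
        ⟨⟨j, fun h0 => by rw [h0] at hj; simp at hj, hj⟩, s⟩
      have h := le_iSup (fun x => LinearMap.range (g x)) x
      rw [← ht] at h
      exact (hg x).ge.trans h
    rw [← hs]
    ext x
    simp only [LinearMap.comp_apply, Submodule.mkQ_apply, LinearMap.zero_apply]
    rw [Submodule.Quotient.mk_eq_zero]
    exact hle ⟨x, rfl⟩
  have hnn : ∀ j ∈ Finset.univ, 0 ≤ (a i * a j) * (hd k R (N j) (N i ⧸ t) : ℚ) := by
    intro j _
    by_cases hj : a i * a j < 0
    · rw [hz j hj]; simp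
    · exact mul_nonneg (not_lt.1 hj) (Nat.cast_nonneg _)
  have h0 := (Finset.sum_eq_zero_iff_of_nonneg hnn).1 hsum' i (Finset.mem_univ _)
  have h1 : hd k R (N i) (N i ⧸ t) = 0 := by
    have : a i * a i ≠ 0 := mul_ne_zero hi hi
    simpa [hi] using h0
  have h2 := hom_zero_of_hd k R h1 t.mkQ
  rw [← t.ker_mkQ, h2, LinearMap.ker_zero]

theorem sum_zero_of_noS {n : ℕ} (P1 P0 S : Fin n → ModuleCat.{0} R)
    [∀ i, Module.Finite R (P1 i)] [∀ i, Module.Finite R (P0 i)]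
    [∀ i, Module.Projective R (P1 i)] [∀ i, Module.Projective R (P0 i)]
    (hS : ∀ X : ModuleCat.{0} R, IsSimpleModule R X → ∃ i, Nonempty (X ≃ₗ[R] S i))
    (a : Fin n → ℚ) (j0 : Fin n)
    (ha : ∀ j, j ≠ j0 → ∑ i, a i * ((hd k R (P0 i) (S j) : ℚ) - hd k R (P1 i) (S j)) = 0)
    (Q : Type) [AddCommGroup Q] [Module R Q] [Module.Finite R Q] (hQ : NoS (R := R) (S j0) Q) :
    ∑ i, a i * ((hd k R (P0 i) Q : ℚ) - hd k R (P1 i) Q) = 0 := by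
  have : IsArtinianRing R := IsArtinianRing.of_finite k R
  have key : ∀ U : Submodule R Q, ∑ i, a i * ((hd k R (P0 i) U : ℚ) - hd k R (P1 i) U) = 0 := by
    by_contra hcon
    push Not at hcon
    obtain ⟨U, hU, hmin⟩ := IsArtinian.set_has_minimal
      {U : Submodule R Q | ∑ i, a i * ((hd k R (P0 i) U : ℚ) - hd k R (P1 i) U) ≠ 0} hcon
    have hnt : Nontrivial U := by
      by_contra hn
      rw [not_nontrivial_iff_subsingleton] at hn
      apply hU
      simp [hd_zero]
    obtain ⟨V, hV⟩ := IsCoatomic.exists_coatom (Submodule R U)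
    have hsim : IsSimpleModule R (U ⧸ V) := isSimpleModule_iff_isCoatom.2 hV
    obtain ⟨j, ⟨ej⟩⟩ := hS (ModuleCat.of R (U ⧸ V)) hsim
    have hj : j ≠ j0 := by
      rintro rfl
      have h1 := (hQ.sub U.subtype U.injective_subtype) (ModuleCat.of R (U ⧸ V)) V.mkQ
        V.mkQ_surjective ej.symm.toLinearMap
      have h2 : Subsingleton (U ⧸ V) := ⟨fun x y => by
        have hx : ∀ x : U ⧸ V, x = 0 := fun x => by
          have := LinearMap.congr_fun h1 (ej x)
          simpa using this
        rw [hx x, hx y]⟩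
      have := IsSimpleModule.nontrivial R (U ⧸ V)
      exact not_subsingleton _ h2
    have hVlt : V.map U.subtype < U := by
      refine lt_of_le_of_ne (Submodule.map_subtype_le U V) fun h => hV.1 ?_
      rw [eq_top_iff]
      intro x _
      have : x.1 ∈ V.map U.subtype := by rw [h]; exact x.2
      obtain ⟨y, hy, hyx⟩ := this
      rw [← Subtype.ext hyx]
      exact hy
    have hV0 : ∑ i, a i * ((hd k R (P0 i) (V.map U.subtype) : ℚ) -
        hd k R (P1 i) (V.map U.subtype)) = 0 := by
      by_contra hne
      exact hmin _ hne hVlt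
    have eV : V ≃ₗ[R] V.map U.subtype := Submodule.equivMapOfInjective _ U.injective_subtype V
    apply hU
    have hfS : Module.Finite R (S j) := Module.Finite.equiv ej
    have hadd : ∀ P : ModuleCat.{0} R, Module.Finite R P → Module.Projective R P →
        hd k R P U = hd k R P (V.map U.subtype) + hd k R P (S j) := by
      intro P _ _
      rw [hd_add k R V.subtype V.mkQ V.injective_subtype V.mkQ_surjective (by simp),
        hd_congr k R eV, hd_congr k R ej]
    rw [← add_zero (0 : ℚ)]
    nth_rewrite 1 [← hV0]
    rw [← ha j hj, ← Finset.sum_add_distrib]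
    refine Finset.sum_congr rfl fun i _ => ?_
    rw [hadd (P0 i) inferInstance inferInstance, hadd (P1 i) inferInstance inferInstance]
    push_cast
    ring
  have h := key ⊤
  rw [← h]
  refine Finset.sum_congr rfl fun i _ => ?_
  rw [hd_congr k R (Submodule.topEquiv (R := R) (M := Q)), hd_congr k R (Submodule.topEquiv (R := R) (M := Q))]

/-- sincerity: every simple module occurs in `M`. -/
theorem sincere (k : Type) [Field k] {R : Type} [Ring R] [Algebra k R] [FiniteDimensional k R]
    {n : ℕ} (N P1 P0 : Fin n → ModuleCat.{0} R)
    [∀ i, Module.Finite R (N i)] [∀ i, Module.Finite R (P1 i)] [∀ i, Module.Finite R (P0 i)]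
    [∀ i, Module.Projective R (P1 i)] [∀ i, Module.Projective R (P0 i)]
    (d1 : ∀ i, P1 i →ₗ[R] P0 i) (d0 : ∀ i, P0 i →ₗ[R] N i)
    (hd0 : ∀ i, Function.Surjective (d0 i))
    (hdd : ∀ i, LinearMap.range (d1 i) = LinearMap.ker (d0 i))
    (M : ModuleCat.{0} R) (e : M ≃ₗ[R] ((i : Fin n) → N i))
    (hfac : ∀ i, ∀ W : ModuleCat.{0} R, MemGen R M W → Ext1Fac (d1 i) W)
    (hN : ∀ i, Indecomp R (N i)) (hiso : ∀ i j, Nonempty ((N i) ≃ₗ[R] (N j)) → i = j)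
    (hcount : SimpleCount R n) (X : ModuleCat.{0} R) (hX : IsSimpleModule R X) :
    ¬ NoS (R := R) X M := by
  intro hno
  have : IsArtinianRing R := IsArtinianRing.of_finite k R
  obtain ⟨S, hS1, hS2, hS3⟩ := hcount
  obtain ⟨j0, ⟨ej⟩⟩ := hS3 X hX
  have hno' : NoS (R := R) (S j0) M := by
    intro W π hπ f
    have := hno W π hπ (f.comp ej.toLinearMap)
    ext x
    have := LinearMap.congr_fun this (ej.symm x)
    simpa using this
  have : Module.Finite R M := Module.Finite.equiv e.symm
  let L : (Fin n → ℚ) →ₗ[ℚ] ({j // j ≠ j0} → ℚ) :=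
    LinearMap.pi fun j => ∑ i, ((hd k R (P0 i) (S j.1) : ℚ) - hd k R (P1 i) (S j.1)) •
      LinearMap.proj i
  have hL : LinearMap.ker L ≠ ⊥ := by
    apply LinearMap.ker_ne_bot_of_finrank_lt
    rw [Module.finrank_fintype_fun_eq_card, Module.finrank_fintype_fun_eq_card]
    exact Fintype.card_subtype_lt (x := j0) (by simp)
  obtain ⟨a, haL, ha0⟩ := Submodule.exists_mem_ne_zero_of_ne_bot hL
  have ha : ∀ j, j ≠ j0 → ∑ i, a i * ((hd k R (P0 i) (S j) : ℚ) - hd k R (P1 i) (S j)) = 0 := by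
    intro j hj
    have := congrFun (show L a = 0 from haL) ⟨j, hj⟩
    simp only [L, LinearMap.pi_apply, LinearMap.sum_apply, LinearMap.smul_apply,
      LinearMap.proj_apply, smul_eq_mul, Pi.zero_apply] at this
    rw [← this]
    exact Finset.sum_congr rfl fun i _ => mul_comm _ _
  have hW : ∀ W : ModuleCat.{0} R, MemGen R M W → ∑ i, a i * (hd k R (N i) W : ℚ) = 0 := by
    intro W hW
    have hW' := hW
    obtain ⟨d, f, hf⟩ := hW
    have : Module.Finite R W := Module.Finite.of_surjective f hf
    rw [← sum_zero_of_noS k P1 P0 S hS3 a j0 ha W ((hno'.pi d).quot f hf)]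
    refine Finset.sum_congr rfl fun i _ => ?_
    rw [hd_pres k R (d1 i) (d0 i) (hd0 i) (hdd i) (hfac i W hW')]
    push_cast
    ring
  have : IsArtinianRing (Module.End R ((i : Fin n) → N i)) := by
    let _ := kMod k R ((i : Fin n) → N i)
    have := kMod_tower k R ((i : Fin n) → N i)
    have := hom_finite k R ((i : Fin n) → N i) ((i : Fin n) → N i)
    have : Module.Finite k (Module.End R ((i : Fin n) → N i)) := this
    exact IsArtinianRing.of_finite k _
  obtain ⟨i, hi⟩ := Function.ne_iff.1 ha0
  exact radical_gen_empty N hN hiso (fun i => a i ≠ 0) (fun i j => a i * a j < 0)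
    (by
      rintro i j h rfl
      exact absurd h (not_lt.2 (mul_self_nonneg _)))
    (fun i hi => top_of_sum_zero k N P1 P0 d1 d0 hd0 hdd M e hfac a hW i hi) i hi

end Sincere

section TauSincere

theorem projective_pi_fin {R : Type} [Ring R] {n : ℕ} (P : Fin n → Type) [∀ i, AddCommGroup (P i)]
    [∀ i, Module R (P i)] [∀ i, Module.Projective R (P i)] :
    Module.Projective R ((i : Fin n) → P i) := by
  classical
  exact Module.Projective.of_equiv (DFinsupp.linearEquivFunOnFintype (R := R) (M := P))

variable (k : Type) [Field k] (C : Type) [Ring C] [Algebra k C] [FiniteDimensional k C]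

theorem tauSincere (M : ModuleCat.{0} Cᵐᵒᵖ) [Module.Finite Cᵐᵒᵖ M] (h : TauTilting k C M)
    (X : ModuleCat.{0} Cᵐᵒᵖ) (hX : IsSimpleModule Cᵐᵒᵖ X) : ¬ NoS (R := Cᵐᵒᵖ) X M := by
  classical
  obtain ⟨hrig, n, N, hN, hiso, ⟨e⟩, hcount⟩ := h
  have : IsArtinianRing Cᵐᵒᵖ := isArtinianRing_op k C
  have hNfin : ∀ i, Module.Finite Cᵐᵒᵖ (N i) := fun i =>
    Module.Finite.of_surjective ((LinearMap.proj i).comp e.toLinearMap) (fun x =>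
      ⟨e.symm (Pi.single i x), by simp⟩)
  choose P1 P0 d1 d0 hmin hf1 hf0 using fun i => exists_minPres (R := Cᵐᵒᵖ) (N i)
  have hp0 : ∀ i, Module.Projective Cᵐᵒᵖ (P0 i) := fun i => (hmin i).1.1
  have hp1 : ∀ i, Module.Projective Cᵐᵒᵖ (P1 i) := fun i => (hmin i).2.1
  let D1 : ((i : Fin n) → P1 i) →ₗ[Cᵐᵒᵖ] ((i : Fin n) → P0 i) :=
    LinearMap.pi fun i => (d1 i).comp (LinearMap.proj i)
  let D0 : ((i : Fin n) → P0 i) →ₗ[Cᵐᵒᵖ] ((i : Fin n) → N i) :=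
    LinearMap.pi fun i => (d0 i).comp (LinearMap.proj i)
  let D0' : ((i : Fin n) → P0 i) →ₗ[Cᵐᵒᵖ] M := e.symm.toLinearMap.comp D0
  have hk0 : LinearMap.ker D0' = LinearMap.ker D0 := by
    rw [LinearMap.ker_comp, LinearEquiv.ker, ← LinearMap.ker]
  have hsup : ∀ {P Q : ModuleCat.{0} Cᵐᵒᵖ} (f : P →ₗ[Cᵐᵒᵖ] Q), (∀ N : Submodule Cᵐᵒᵖ P,
    N ⊔ LinearMap.ker f = ⊤ → N = ⊤) → Superfl (LinearMap.ker f) := fun f h => h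
  have hMin : IsMinPres Cᵐᵒᵖ (P1 := ModuleCat.of Cᵐᵒᵖ ((i : Fin n) → P1 i))
      (P0 := ModuleCat.of Cᵐᵒᵖ ((i : Fin n) → P0 i)) D1 D0' := by
    refine ⟨⟨?_, ?_, ?_⟩, ?_, ?_, ?_⟩
    · change Module.Projective Cᵐᵒᵖ ((i : Fin n) → P0 i)
      exact projective_pi_fin _
    · intro x
      choose y hy using fun i => (hmin i).1.2.1 (e x i)
      refine ⟨y, ?_⟩
      change e.symm (D0 y) = x
      rw [LinearEquiv.symm_apply_eq]
      ext i
      exact hy i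
    · exact superfl_pi (fun i => LinearMap.ker (d0 i)) (fun i => (hmin i).1.2.2) _ (fun x hx i => by
        have hx : x ∈ LinearMap.ker D0' := hx
        rw [hk0] at hx
        exact congrFun (show D0 x = 0 from hx) i)
    · change Module.Projective Cᵐᵒᵖ ((i : Fin n) → P1 i)
      exact projective_pi_fin _
    · change LinearMap.range D1 = LinearMap.ker D0'
      rw [hk0]
      ext x
      constructor
      · rintro ⟨y, rfl⟩
        ext i
        have : d1 i (y i) ∈ LinearMap.ker (d0 i) := by rw [← (hmin i).2.2.1]; exact ⟨_, rfl⟩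
        exact this
      · intro hx
        have : ∀ i, ∃ y, d1 i y = x i := fun i => by
          have : x i ∈ LinearMap.ker (d0 i) := congrFun (show D0 x = 0 from hx) i
          rw [← (hmin i).2.2.1] at this
          exact this
        choose y hy using this
        exact ⟨y, funext hy⟩
    · exact superfl_pi (fun i => LinearMap.ker (d1 i)) (fun i => (hmin i).2.2.2) _ (fun x hx i => by
        exact congrFun (show D1 x = 0 from hx) i)
  have : Module.Finite Cᵐᵒᵖ (ModuleCat.of Cᵐᵒᵖ ((i : Fin n) → P1 i)) := by
    change Module.Finite Cᵐᵒᵖ ((i : Fin n) → P1 i)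
    infer_instance
  have hfac := ext1Fac_of_tauRigid k C _ _ hMin hrig
  refine sincere k N P1 P0 d1 d0 (fun i => (hmin i).1.2.1) (fun i => (hmin i).2.2.1) M e ?_ hN hiso
    hcount X hX
  intro i W hW
  refine Ext1Fac.gen (M := M) ?_ hW
  intro u
  obtain ⟨v, hv⟩ := hfac (u.comp (LinearMap.proj i))
  refine ⟨v.comp (LinearMap.single Cᵐᵒᵖ (fun i => P0 i) i), ?_⟩
  ext x
  have := LinearMap.congr_fun hv (Pi.single i x)
  have h2 : D1 (Pi.single i x) = Pi.single i (d1 i x) := by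
    ext j
    by_cases hj : j = i
    · subst hj; simp [D1]
    · simp [D1, Pi.single_eq_of_ne hj]
  simp only [LinearMap.comp_apply, LinearMap.proj_apply, Pi.single_eq_same] at this
  rw [this]
  exact congrArg v h2

theorem ext1Zero_of_tauRigid (M : ModuleCat.{0} Cᵐᵒᵖ) [Module.Finite Cᵐᵒᵖ M] (h : TauRigid k C M)
    (N : ModuleCat.{0} Cᵐᵒᵖ) (hN : MemGen Cᵐᵒᵖ M N) : Ext1Zero Cᵐᵒᵖ M N := by
  have : IsArtinianRing Cᵐᵒᵖ := isArtinianRing_op k C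
  obtain ⟨P1, P0, d1, d0, hmin, hf1, hf0⟩ := exists_minPres (R := Cᵐᵒᵖ) M
  have := hmin.1.1
  have := hmin.2.1
  exact ext1Zero_of_ext1Fac d1 d0 hmin.1.2.1 hmin.2.2.1
    ((ext1Fac_of_tauRigid k C d1 d0 hmin h).gen hN)

end TauSincere

section Res

variable {R : Type} [Ring R]
variable {P2 P1 P0 Q2 Q1 Q0 X : Type} [AddCommGroup P2] [Module R P2] [AddCommGroup P1] [Module R P1]
  [AddCommGroup P0] [Module R P0] [AddCommGroup Q2] [Module R Q2] [AddCommGroup Q1] [Module R Q1]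
  [AddCommGroup Q0] [Module R Q0] [AddCommGroup X] [Module R X]

theorem exact_apply {d2 : P2 →ₗ[R] P1} {d1 : P1 →ₗ[R] P0}
    (h : LinearMap.range d2 = LinearMap.ker d1) (x : P2) : d1 (d2 x) = 0 := by
  have : d2 x ∈ LinearMap.ker d1 := h ▸ ⟨x, rfl⟩
  exact this

/-- lifting through an exact sequence -/
theorem lift_exact {Y : Type} [AddCommGroup Y] [Module R Y] [Module.Projective R Y]
    (d1 : P1 →ₗ[R] P0) (d0 : P0 →ₗ[R] X) (h : LinearMap.range d1 = LinearMap.ker d0)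
    (f : Y →ₗ[R] P0) (hf : ∀ y, d0 (f y) = 0) : ∃ g : Y →ₗ[R] P1, ∀ y, d1 (g y) = f y := by
  have hf' : ∀ y, f y ∈ LinearMap.range d1 := fun y => by rw [h]; exact hf y
  obtain ⟨g, hg⟩ := Module.projective_lifting_property d1.rangeRestrict
    (f.codRestrict _ hf') d1.surjective_rangeRestrict
  refine ⟨g, fun y => ?_⟩
  exact congrArg Subtype.val (LinearMap.congr_fun hg y)

theorem chain_lift [Module.Projective R P0] [Module.Projective R P1]
    (d2 : P2 →ₗ[R] P1) (d1 : P1 →ₗ[R] P0) (d0 : P0 →ₗ[R] X)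
    (e2 : Q2 →ₗ[R] Q1) (e1 : Q1 →ₗ[R] Q0) (e0 : Q0 →ₗ[R] X)
    (hd21 : LinearMap.range d2 = LinearMap.ker d1) (hd10 : LinearMap.range d1 = LinearMap.ker d0)
    (he2 : Function.Injective e2) (he0 : Function.Surjective e0)
    (he21 : LinearMap.range e2 = LinearMap.ker e1) (he10 : LinearMap.range e1 = LinearMap.ker e0) :
    ∃ (a2 : P2 →ₗ[R] Q2) (a1 : P1 →ₗ[R] Q1) (a0 : P0 →ₗ[R] Q0),
      (∀ x, e0 (a0 x) = d0 x) ∧ (∀ x, e1 (a1 x) = a0 (d1 x)) ∧ (∀ x, e2 (a2 x) = a1 (d2 x)) := by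
  obtain ⟨a0, ha0⟩ := Module.projective_lifting_property e0 d0 he0
  have ha0' : ∀ x, e0 (a0 x) = d0 x := fun x => LinearMap.congr_fun ha0 x
  obtain ⟨a1, ha1⟩ := lift_exact e1 e0 he10 (a0.comp d1) (fun y => by
    simp [ha0', exact_apply hd10])
  obtain ⟨a2, ha2⟩ := exists_factor e2 he2 (a1.comp d2) (fun y => by
    rw [he21, LinearMap.mem_ker]
    simp [ha1, exact_apply hd21])
  exact ⟨a2, a1, a0, ha0', ha1, ha2⟩

theorem chain_homotopy [Module.Projective R Q0] [Module.Projective R Q1]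
    (e2 : Q2 →ₗ[R] Q1) (e1 : Q1 →ₗ[R] Q0) (e0 : Q0 →ₗ[R] X)
    (he2 : Function.Injective e2)
    (he21 : LinearMap.range e2 = LinearMap.ker e1) (he10 : LinearMap.range e1 = LinearMap.ker e0)
    (f2 : Q2 →ₗ[R] Q2) (f1 : Q1 →ₗ[R] Q1) (f0 : Q0 →ₗ[R] Q0)
    (h0 : ∀ x, e0 (f0 x) = e0 x) (h1 : ∀ x, e1 (f1 x) = f0 (e1 x))
    (h2 : ∀ x, e2 (f2 x) = f1 (e2 x)) : ∃ s : Q1 →ₗ[R] Q2, ∀ x, f2 x = x + s (e2 x) := by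
  obtain ⟨s0, hs0⟩ := lift_exact e1 e0 he10 (f0 - LinearMap.id) (fun y => by simp [h0])
  obtain ⟨s1, hs1⟩ := exists_factor e2 he2 (f1 - LinearMap.id - s0.comp e1) (fun y => by
    rw [he21, LinearMap.mem_ker]
    simp [hs0, h1])
  refine ⟨s1, fun x => he2 ?_⟩
  rw [map_add, hs1, h2]
  simp [exact_apply he21]

end Res

section RelExtFG

variable (k : Type) [Field k] (C : Type) [Ring C] [Algebra k C] [FiniteDimensional k C]

/-- `DC` with its pairing -/
def IsDC (DC : ModuleCat.{0} Cᵐᵒᵖ) : Prop :=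
  ∃ φ : DC → C → k,
    (∀ n n' m, φ (n + n') m = φ n m + φ n' m) ∧
    (∀ n m m', φ n (m + m') = φ n m + φ n m') ∧
    (∀ (c : k) n m, φ n ((algebraMap k C c) * m) = c * φ n m) ∧
    (∀ (a : C) n m, φ (op a • n) m = φ n (a * m)) ∧
    (∀ n, (∀ m, φ n m = 0) → n = 0) ∧
    (∀ m, (∀ n, φ n m = 0) → m = 0)

variable {C}

theorem IsDC.finite {DC : ModuleCat.{0} Cᵐᵒᵖ} (h : IsDC k C DC) : Module.Finite Cᵐᵒᵖ DC := by
  obtain ⟨φ, h1, h2, h3, h4, h5, h6⟩ := h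
  let _ := kMod k Cᵐᵒᵖ DC
  have := kMod_tower k Cᵐᵒᵖ DC
  let Φ : DC →ₗ[k] (C →ₗ[k] k) :=
    { toFun := fun n =>
        { toFun := φ n
          map_add' := h2 n
          map_smul' := fun c m => by rw [Algebra.smul_def]; exact h3 c n m }
      map_add' := fun n n' => by ext m; exact h1 n n' m
      map_smul' := fun c n => by
        ext m
        change φ (op (algebraMap k C c) • n) m = c * φ n m
        rw [h4, h3] }
  have hΦ : Function.Injective Φ := by
    rw [← LinearMap.ker_eq_bot, eq_bot_iff]
    intro n hn
    exact h5 n (fun m => LinearMap.congr_fun (show Φ n = 0 from hn) m)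
  have : Module.Finite k DC := Module.Finite.of_injective Φ hΦ
  exact Module.Finite.of_restrictScalars_finite k Cᵐᵒᵖ DC

/-- every f.g. module embeds in a power of `DC`. -/
theorem IsDC.embed {DC : ModuleCat.{0} Cᵐᵒᵖ} (h : IsDC k C DC) (X : Type) [AddCommGroup X]
    [Module Cᵐᵒᵖ X] [Module.Finite Cᵐᵒᵖ X] :
    ∃ (r : ℕ) (i : X →ₗ[Cᵐᵒᵖ] (Fin r → DC)), Function.Injective i := by
  obtain ⟨φ, h1, h2, h3, h4, h5, h6⟩ := h
  let _ := kMod k Cᵐᵒᵖ DC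
  have := kMod_tower k Cᵐᵒᵖ DC
  let Φ : DC →ₗ[k] (C →ₗ[k] k) :=
    { toFun := fun n =>
        { toFun := φ n
          map_add' := h2 n
          map_smul' := fun c m => by rw [Algebra.smul_def]; exact h3 c n m }
      map_add' := fun n n' => by ext m; exact h1 n n' m
      map_smul' := fun c n => by
        ext m
        change φ (op (algebraMap k C c) • n) m = c * φ n m
        rw [h4, h3] }
  have hrep : ∀ g : C →ₗ[k] k, ∃ n, Φ n = g := by
    have : LinearMap.range Φ = ⊤ := by
      have h0 : (LinearMap.range Φ).dualCoannihilator = ⊥ := by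
        rw [eq_bot_iff]
        intro m hm
        rw [Submodule.mem_dualCoannihilator] at hm
        exact h6 m (fun n => hm (Φ n) ⟨n, rfl⟩)
      have h00 := Subspace.dualCoannihilator_dualAnnihilator_eq (W := LinearMap.range Φ)
      rw [← h00, h0]
      simp
    intro g
    have : g ∈ LinearMap.range Φ := by rw [this]; trivial
    exact this
  let _ := kMod k Cᵐᵒᵖ X
  have := kMod_tower k Cᵐᵒᵖ X
  have : Module.Finite k X := Module.Finite.trans Cᵐᵒᵖ X
  let b := Module.finBasis k X
  let g : Fin (Module.finrank k X) → X → (C →ₗ[k] k) := fun l x =>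
    { toFun := fun c => b.repr (op c • x) l
      map_add' := fun c c' => by rw [MulOpposite.op_add, add_smul]; simp
      map_smul' := fun a c => by rw [MulOpposite.op_smul, smul_assoc]; simp }
  choose ψ hψ using fun l x => hrep (g l x)
  have hψ' : ∀ l x c, φ (ψ l x) c = b.repr (op c • x) l := fun l x c =>
    LinearMap.congr_fun (hψ l x) c
  have hinj : ∀ n n', (∀ c, φ n c = φ n' c) → n = n' := fun n n' h => by
    rw [← sub_eq_zero]
    apply h5
    intro m
    have : φ (n - n' + n') m = φ n m := by rw [sub_add_cancel]
    rw [h1] at this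
    rw [h m] at this
    simpa using this
  refine ⟨Module.finrank k X, LinearMap.pi fun l =>
    { toFun := ψ l
      map_add' := fun x y => hinj _ _ fun c => by rw [h1, hψ', hψ', hψ', smul_add]; simp
      map_smul' := fun c x => hinj _ _ fun c' => by
        obtain ⟨c⟩ := c
        change φ (ψ l (op c • x)) c' = φ (op c • (ψ l x)) c'
        rw [h4, hψ', hψ', smul_smul, ← MulOpposite.op_mul] }, ?_⟩
  rw [← LinearMap.ker_eq_bot, eq_bot_iff]
  intro x hx
  have hx' : ∀ l, ψ l x = 0 := fun l => congrFun hx l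
  have h00 : ∀ c, φ 0 c = 0 := fun c => by
    have := h1 0 0 c
    rw [add_zero] at this
    simpa using this
  have : b.repr x = 0 := by
    ext l
    have := hψ' l x 1
    rw [hx', h00, MulOpposite.op_one, one_smul] at this
    exact this.symm
  simpa using this

theorem relExt_fg {E : Type} [AddCommGroup E] [Module C E] [Module Cᵐᵒᵖ E] (hE : IsRelExt k C E) :
    ∃ (DC : ModuleCat.{0} Cᵐᵒᵖ), IsDC k C DC ∧
    ∃ (P2 P1 P0 : ModuleCat.{0} Cᵐᵒᵖ) (d2 : P2 →ₗ[Cᵐᵒᵖ] P1) (d1 : P1 →ₗ[Cᵐᵒᵖ] P0)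
      (d0 : P0 →ₗ[Cᵐᵒᵖ] DC),
      Module.Projective Cᵐᵒᵖ P2 ∧ Module.Projective Cᵐᵒᵖ P1 ∧
      Module.Projective Cᵐᵒᵖ P0 ∧
      Module.Finite Cᵐᵒᵖ P2 ∧ Module.Finite Cᵐᵒᵖ P1 ∧ Module.Finite Cᵐᵒᵖ P0 ∧
      Function.Injective d2 ∧ Function.Surjective d0 ∧
      LinearMap.range d2 = LinearMap.ker d1 ∧
      LinearMap.range d1 = LinearMap.ker d0 ∧
      ∃ q : (P2 →ₗ[Cᵐᵒᵖ] C) →ₗ[C] E,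
        Function.Surjective q ∧
        (∀ g : P2 →ₗ[Cᵐᵒᵖ] C, q g = 0 ↔ ∃ f : P1 →ₗ[Cᵐᵒᵖ] C, g = f.comp d2) := by
  obtain ⟨DC, φ, h1, h2, h3, h4, h5, h6, P2, P1, P0, d2, d1, d0, hp2, hp1, hp0, hd2, hd0, hd21,
    hd10, q, hq, hq0, -⟩ := hE
  have hDC : IsDC k C DC := ⟨φ, h1, h2, h3, h4, h5, h6⟩
  have := hDC.finite k
  have : IsArtinianRing Cᵐᵒᵖ := isArtinianRing_op k C
  obtain ⟨n0, e0, he0⟩ := Module.Finite.exists_fin' Cᵐᵒᵖ DC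
  obtain ⟨n1, e1', he1'⟩ := Module.Finite.exists_fin' Cᵐᵒᵖ (LinearMap.ker e0)
  let e1 := (LinearMap.ker e0).subtype.comp e1'
  let e2 := (LinearMap.ker e1).subtype
  have he2 : Function.Injective e2 := Submodule.injective_subtype _
  have he10 : LinearMap.range e1 = LinearMap.ker e0 := by
    rw [LinearMap.range_comp, LinearMap.range_eq_top.2 he1', Submodule.map_top,
      Submodule.range_subtype]
  have he21 : LinearMap.range e2 = LinearMap.ker e1 := Submodule.range_subtype _
  obtain ⟨a2, a1, a0, ha0, ha1, ha2⟩ := chain_lift d2 d1 d0 e2 e1 e0 hd21 hd10 he2 he0 he21 he10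
  obtain ⟨b2, b1, b0, hb0, hb1, hb2⟩ := chain_lift e2 e1 e0 d2 d1 d0 he21 he10 hd2 hd0 hd21 hd10
  obtain ⟨s, hs⟩ := chain_homotopy e2 e1 e0 he2 he21 he10 (a2.comp b2) (a1.comp b1) (a0.comp b0)
    (by simp [ha0, hb0]) (by simp [ha1, hb1]) (by simp [ha2, hb2])
  obtain ⟨t, ht⟩ := chain_homotopy d2 d1 d0 hd2 hd21 hd10 (b2.comp a2) (b1.comp a1) (b0.comp a0)
    (by simp [ha0, hb0]) (by simp [ha1, hb1]) (by simp [ha2, hb2])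
  have hproj : Module.Projective Cᵐᵒᵖ (LinearMap.ker e1) := by
    refine Module.Projective.of_split (P := LinearMap.ker e1) (M := P2 × (Fin n1 → Cᵐᵒᵖ))
      (LinearMap.prod b2 e2) (a2.coprod (-s)) ?_
    ext1 x
    have := hs x
    change a2 (b2 x) = _ at this
    change a2 (b2 x) + -(s (e2 x)) = x
    rw [this]; abel
  refine ⟨DC, hDC, ModuleCat.of _ (LinearMap.ker e1), ModuleCat.of _ (Fin n1 → Cᵐᵒᵖ),
    ModuleCat.of _ (Fin n0 → Cᵐᵒᵖ), e2, e1, e0, hproj, ?_, ?_, ?_, ?_, ?_, he2, he0, he21, he10,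
    ?_⟩
  · change Module.Projective Cᵐᵒᵖ (Fin n1 → Cᵐᵒᵖ); infer_instance
  · change Module.Projective Cᵐᵒᵖ (Fin n0 → Cᵐᵒᵖ); infer_instance
  · change Module.Finite Cᵐᵒᵖ (LinearMap.ker e1); infer_instance
  · change Module.Finite Cᵐᵒᵖ (Fin n1 → Cᵐᵒᵖ); infer_instance
  · change Module.Finite Cᵐᵒᵖ (Fin n0 → Cᵐᵒᵖ); infer_instance
  let q' : (LinearMap.ker e1 →ₗ[Cᵐᵒᵖ] C) →ₗ[C] E :=
    { toFun := fun h => q (h.comp a2)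
      map_add' := fun h h' => by rw [← map_add]; rfl
      map_smul' := fun c h => by rw [RingHom.id_apply, ← map_smul]; rfl }
  refine ⟨q', fun x => ?_, fun g => ?_⟩
  · obtain ⟨g, rfl⟩ := hq x
    refine ⟨g.comp b2, ?_⟩
    change q ((g.comp b2).comp a2) = q g
    rw [← sub_eq_zero, ← map_sub, hq0]
    refine ⟨g.comp t, ?_⟩
    ext x
    have := ht x
    simp only [LinearMap.comp_apply, LinearMap.sub_apply] at this ⊢
    rw [this, map_add]; abel
  · change q (g.comp a2) = 0 ↔ _
    rw [hq0]
    constructor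
    · rintro ⟨f, hf⟩
      refine ⟨f.comp b1 - g.comp s, ?_⟩
      ext1 x
      have h1 := hs x
      have h2 := LinearMap.congr_fun hf (b2 x)
      simp only [LinearMap.comp_apply, LinearMap.sub_apply] at h1 h2 ⊢
      rw [hb2] at h2
      change _ = f (b1 (e2 x)) - g (s (e2 x))
      rw [← h2, h1, map_add]; abel
    · rintro ⟨f, hf⟩
      refine ⟨f.comp a1, ?_⟩
      ext1 x
      rw [hf]
      exact congrArg f (ha2 x)

/-- `Ext²(DC,C)` is a f.g. left module -/
theorem relExt_finite {E : Type} [AddCommGroup E] [Module C E] {P2 : ModuleCat.{0} Cᵐᵒᵖ}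
    [Module.Projective Cᵐᵒᵖ P2] [Module.Finite Cᵐᵒᵖ P2]
    (q : (P2 →ₗ[Cᵐᵒᵖ] C) →ₗ[C] E) (hq : Function.Surjective q) : Module.Finite C E := by
  obtain ⟨n, y, ys, hy⟩ := exists_dualBasis (A := C) P2
  refine Module.Finite.of_surjective (M := Fin n → C) (P := E)
    (∑ i, ((LinearMap.toSpanSingleton C E (q (ys i)))).comp (LinearMap.proj i)) ?_
  intro x
  obtain ⟨g, rfl⟩ := hq x
  refine ⟨fun i => g (y i), ?_⟩
  simp only [LinearMap.sum_apply, LinearMap.comp_apply, LinearMap.proj_apply,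
    LinearMap.toSpanSingleton_apply]
  have := eq_sum_smul_dual y ys hy g
  nth_rewrite 2 [this]
  rw [map_sum]
  simp

end RelExtFG

section IdPart

variable {R : Type} [Ring R]
variable {P2 P1 P0 : Type} [AddCommGroup P2] [Module R P2] [AddCommGroup P1] [Module R P1]
  [AddCommGroup P0] [Module R P0]

theorem ext2_of_idLE1 {M : ModuleCat.{0} R} (h : IdLE1 R M) [Module.Projective R P0]
    (d2 : P2 →ₗ[R] P1) (d1 : P1 →ₗ[R] P0) (hd2 : Function.Injective d2)
    (hd21 : LinearMap.range d2 = LinearMap.ker d1) : Ext1Fac d2 M := by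
  obtain ⟨I0, I1, i, p, hI0, hI1, hi, hp, hip⟩ := h
  intro u
  obtain ⟨g, hg⟩ := hI0.out d2 hd2 (i.comp u)
  obtain ⟨w0, hw0⟩ := exists_descend d1.rangeRestrict d1.surjective_rangeRestrict (p.comp g)
    (fun x hx => by
      have : x ∈ LinearMap.ker d1 := congrArg Subtype.val hx
      rw [← hd21] at this
      obtain ⟨y, rfl⟩ := this
      rw [LinearMap.comp_apply, hg]
      exact exact_apply hip _)
  obtain ⟨w, hw⟩ := hI1.out (LinearMap.range d1).subtype (Submodule.injective_subtype _) w0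
  obtain ⟨w', hw'⟩ := Module.projective_lifting_property p w hp
  have hw'' : ∀ x, p (w' x) = w x := fun x => LinearMap.congr_fun hw' x
  obtain ⟨v, hv⟩ := exists_factor i hi (g - w'.comp d1) (fun y => by
    rw [hip, LinearMap.mem_ker]
    have h1 := hw0 y
    have h2 := hw (d1.rangeRestrict y)
    rw [h1] at h2
    simp only [LinearMap.sub_apply, LinearMap.comp_apply, map_sub, hw'']
    rw [sub_eq_zero]
    exact h2.symm)
  refine ⟨v, ?_⟩
  ext x
  apply hi
  rw [LinearMap.comp_apply, hv]
  simp [hg, exact_apply hd21]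

end IdPart

section ExtB

variable {C : Type} [Ring C] {E : Type} [AddCommGroup E]
  [Module C E] [Module Cᵐᵒᵖ E] [SMulCommClass C Cᵐᵒᵖ E]

theorem modB_smul (M : Mdl Cᵐᵒᵖ) (b : TrivSqZeroExt C E) (m : modB C E M) :
    op b • m = (show modB C E M from (op b.fst • (show M from m) : M)) := rfl

theorem modInl_smul (Z : Mdl (TrivSqZeroExt C E)ᵐᵒᵖ) (c : C) (m : modAlong (tszeInl C E) Z) :
    op c • m = (show modAlong (tszeInl C E) Z from
      (op (TrivSqZeroExt.inl c : TrivSqZeroExt C E) • (show Z from m) : Z)) := rfl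

theorem ext1Zero_B (M : Mdl Cᵐᵒᵖ)
    (hbal : ∀ (V : Type) [AddCommGroup V] (β : M → E → V),
      (∀ m m' e, β (m + m') e = β m e + β m' e) → (∀ m e e', β m (e + e') = β m e + β m e') →
      (∀ m (a : C) e, β (op a • m) e = β m (a • e)) → ∀ m e, β m e = 0)
    (hC : ∀ N : Mdl Cᵐᵒᵖ, MemGen Cᵐᵒᵖ M N → Ext1Zero Cᵐᵒᵖ M N)
    (N : Mdl (TrivSqZeroExt C E)ᵐᵒᵖ) (hN : MemGen _ (modB C E M) N) :
    Ext1Zero _ (modB C E M) N := by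
  obtain ⟨d, f, hf⟩ := hN
  intro Z i p hi hp hip
  have hMe : ∀ (e : E) (m : modB C E M), op (TrivSqZeroExt.inr e : TrivSqZeroExt C E) • m = 0 := by
    intro e m
    change (op (0 : C) • (show M from m) : M) = 0
    rw [MulOpposite.op_zero, zero_smul]
  have hNe : ∀ (e : E) (x : N), op (TrivSqZeroExt.inr e : TrivSqZeroExt C E) • x = 0 := by
    intro e x
    obtain ⟨y, rfl⟩ := hf x
    rw [← map_smul]
    have : op (TrivSqZeroExt.inr e : TrivSqZeroExt C E) • y = 0 := by
      ext j
      exact hMe e (y j)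
    rw [this, map_zero]
  have hker : ∀ (e : E) (z : Z), p z = 0 → op (TrivSqZeroExt.inr e : TrivSqZeroExt C E) • z = 0 := by
    intro e z hz
    have : z ∈ LinearMap.range i := by rw [hip]; exact hz
    obtain ⟨x, rfl⟩ := this
    rw [← map_smul, hNe, map_zero]
  have heq : ∀ (e : E) (z z' : Z), p z = p z' → op (TrivSqZeroExt.inr e : TrivSqZeroExt C E) • z =
      op (TrivSqZeroExt.inr e : TrivSqZeroExt C E) • z' := by
    intro e z z' h
    rw [← sub_eq_zero, ← smul_sub]
    exact hker e _ (by rw [map_sub, h, sub_self])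
  let σ : M → Z := Function.surjInv hp
  have hσ : ∀ m, p (σ m) = m := Function.surjInv_eq hp
  have hβ := hbal Z (fun m e => op (TrivSqZeroExt.inr e : TrivSqZeroExt C E) • σ m)
    (fun m m' e => by
      rw [← smul_add]
      apply heq
      rw [map_add, hσ, hσ, hσ]
      rfl)
    (fun m e e' => by rw [← add_smul, ← MulOpposite.op_add, ← TrivSqZeroExt.inr_add])
    (fun m c e => by
      have h1 : op (TrivSqZeroExt.inr e : TrivSqZeroExt C E) • σ (op c • m) =
        op (TrivSqZeroExt.inr e : TrivSqZeroExt C E) •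
          (op (TrivSqZeroExt.inl c : TrivSqZeroExt C E) • σ m) := by
        apply heq
        rw [map_smul, hσ, hσ]
        rfl
      change op (TrivSqZeroExt.inr e : TrivSqZeroExt C E) • σ (op c • m) = _
      rw [h1, smul_smul, ← MulOpposite.op_mul, TrivSqZeroExt.inl_mul_inr])
  have hZe : ∀ (e : E) (z : Z), op (TrivSqZeroExt.inr e : TrivSqZeroExt C E) • z = 0 := by
    intro e z
    have h1 := heq e z (σ (p z)) (hσ (p z)).symm
    rw [h1]
    exact hβ (p z) e
  have hgen : MemGen Cᵐᵒᵖ M (modAlong (tszeInl C E) N) := by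
    refine ⟨d, { toFun := fun x => f x, map_add' := fun x y => f.map_add x y, map_smul' := ?_ }, hf⟩
    intro c x
    obtain ⟨c⟩ := c
    exact f.map_smul (op (TrivSqZeroExt.inl c)) x
  let i' : modAlong (tszeInl C E) N →ₗ[Cᵐᵒᵖ] modAlong (tszeInl C E) Z :=
    { toFun := fun x => i x
      map_add' := fun x y => i.map_add x y
      map_smul' := fun c x => i.map_smul (op (TrivSqZeroExt.inl c.unop)) x }
  let p' : modAlong (tszeInl C E) Z →ₗ[Cᵐᵒᵖ] M :=
    { toFun := fun x => p x
      map_add' := fun x y => p.map_add x y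
      map_smul' := fun c x => p.map_smul (op (TrivSqZeroExt.inl c.unop)) x }
  have hip' : LinearMap.range i' = LinearMap.ker p' := by
    ext x
    exact SetLike.ext_iff.1 hip x
  obtain ⟨s, hs⟩ := hC _ hgen (modAlong (tszeInl C E) Z) i' p' hi hp hip'
  refine ⟨{ toFun := fun m => s m, map_add' := fun x y => s.map_add x y, map_smul' := ?_ }, ?_⟩
  · rintro ⟨b⟩ m
    have h1 := s.map_smul (op b.fst) m
    refine Eq.trans h1 ?_
    change (op (TrivSqZeroExt.inl b.fst : TrivSqZeroExt C E) • (show Z from s m) : Z) =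
      (op b • (show Z from s m) : Z)
    rw [← TrivSqZeroExt.inl_fst_add_inr_snd_eq b, MulOpposite.op_add, add_smul, hZe, add_zero]
    simp
  · ext m
    exact LinearMap.congr_fun hs m

theorem balanced_zero_of_ext1Zero_B (M N : Mdl Cᵐᵒᵖ) (h : Ext1Zero _ (modB C E M) (modB C E N))
    (β : M → E → N) (h1 : ∀ m m' e, β (m + m') e = β m e + β m' e)
    (h2 : ∀ m e e', β m (e + e') = β m e + β m e')
    (h3 : ∀ m (a : C) e, β (op a • m) e = β m (a • e))
    (h4 : ∀ m (a : C) e, β m (op a • e) = op a • β m e) (m : M) (e : E) : β m e = 0 := by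
  have h1z : ∀ e, β 0 e = 0 := fun e => by simpa using h1 0 0 e
  have h2z : ∀ m, β m 0 = 0 := fun m => by simpa using h2 m 0 0
  let inst : Module (TrivSqZeroExt C E)ᵐᵒᵖ (N × M) :=
    { smul := fun b x => (op b.unop.fst • x.1 + β x.2 b.unop.snd, op b.unop.fst • x.2)
      one_smul := fun x => by
        change (op (1 : C) • x.1 + β x.2 0, op (1 : C) • x.2) = x
        rw [h2z, MulOpposite.op_one, one_smul, one_smul, add_zero]
      mul_smul := fun b b' x => by
        obtain ⟨b⟩ := b
        obtain ⟨b'⟩ := b'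
        change (op (b'.fst * b.fst) • x.1 + β x.2 (b'.fst • b.snd + op b.fst • b'.snd),
          op (b'.fst * b.fst) • x.2) =
          (op b.fst • (op b'.fst • x.1 + β x.2 b'.snd) + β (op b'.fst • x.2) b.snd,
            op b.fst • (op b'.fst • x.2))
        rw [MulOpposite.op_mul, mul_smul, mul_smul, smul_add, h2, h4, h3]
        congr 1
        abel
      smul_zero := fun b => by
        change (op b.unop.fst • (0 : N) + β 0 b.unop.snd, op b.unop.fst • (0 : M)) = 0
        rw [h1z, smul_zero, smul_zero, add_zero]
        rfl
      smul_add := fun b x y => by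
        change (op b.unop.fst • (x.1 + y.1) + β (x.2 + y.2) b.unop.snd,
          op b.unop.fst • (x.2 + y.2)) =
          ((op b.unop.fst • x.1 + β x.2 b.unop.snd) + (op b.unop.fst • y.1 + β y.2 b.unop.snd),
            op b.unop.fst • x.2 + op b.unop.fst • y.2)
        rw [h1, smul_add, smul_add]
        congr 1
        abel
      add_smul := fun b b' x => by
        change (op (b.unop.fst + b'.unop.fst) • x.1 + β x.2 (b.unop.snd + b'.unop.snd),
          op (b.unop.fst + b'.unop.fst) • x.2) =
          ((op b.unop.fst • x.1 + β x.2 b.unop.snd) + (op b'.unop.fst • x.1 + β x.2 b'.unop.snd),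
            op b.unop.fst • x.2 + op b'.unop.fst • x.2)
        rw [h2, MulOpposite.op_add, add_smul, add_smul]
        congr 1
        abel
      zero_smul := fun x => by
        change (op (0 : C) • x.1 + β x.2 0, op (0 : C) • x.2) = 0
        rw [h2z, MulOpposite.op_zero, zero_smul, zero_smul, add_zero]
        rfl }
  let i : modB C E N →ₗ[(TrivSqZeroExt C E)ᵐᵒᵖ] ModuleCat.of (TrivSqZeroExt C E)ᵐᵒᵖ (N × M) :=
    { toFun := fun x => ((show N from x, 0) : N × M)
      map_add' := fun x y => by
        change (((show N from x) + (show N from y), (0 : M)) : N × M) =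
          ((show N from x) + (show N from y), 0 + 0)
        rw [add_zero]
      map_smul' := fun b x => by
        change ((op b.unop.fst • (show N from x), (0 : M)) : N × M) =
          (op b.unop.fst • (show N from x) + β 0 b.unop.snd, op b.unop.fst • (0 : M))
        rw [h1z, smul_zero, add_zero] }
  let p : ModuleCat.of (TrivSqZeroExt C E)ᵐᵒᵖ (N × M) →ₗ[(TrivSqZeroExt C E)ᵐᵒᵖ] modB C E M :=
    { toFun := fun x => (show N × M from x).2
      map_add' := fun x y => rfl
      map_smul' := fun b x => rfl }
  obtain ⟨s, hs⟩ := h (ModuleCat.of (TrivSqZeroExt C E)ᵐᵒᵖ (N × M)) i p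
    (fun x y hxy => congrArg (fun z : N × M => z.1) hxy) (fun x => ⟨((0, x) : N × M), rfl⟩)
    (by
      ext x
      constructor
      · rintro ⟨y, rfl⟩; rfl
      · intro hx
        refine ⟨(show N × M from x).1, ?_⟩
        exact Prod.ext rfl (Eq.symm hx))
  have hs2 : ∀ m : M, (show N × M from s m).2 = m := fun m => LinearMap.congr_fun hs m
  have h5 := s.map_smul (op (TrivSqZeroExt.inr e)) m
  have h6 : (op (TrivSqZeroExt.inr e : TrivSqZeroExt C E) • (show modB C E M from m)) = 0 := by
    change (op (0 : C) • m : M) = 0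
    rw [MulOpposite.op_zero, zero_smul]
  have h7 : s (op (TrivSqZeroExt.inr e : TrivSqZeroExt C E) • (show modB C E M from m)) = 0 := by
    rw [h6, map_zero]
  have h8 := h5.symm.trans h7
  have h9 : op (0 : C) • (show N × M from s m).1 + β (show N × M from s m).2 e = 0 :=
    congrArg (fun z : N × M => z.1) h8
  rw [MulOpposite.op_zero, zero_smul, zero_add, hs2] at h9
  exact h9

end ExtB

section Tens
open TensorProduct

theorem balanced_zero_of_gen (k : Type) [Field k] {C : Type} [Ring C] [Algebra k C] [FiniteDimensional k C]
    {E : Type} [AddCommGroup E]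
    [Module C E] [Module Cᵐᵒᵖ E] [SMulCommClass C Cᵐᵒᵖ E] [Module.Finite Cᵐᵒᵖ E]
    (M : Mdl Cᵐᵒᵖ) [Module.Finite Cᵐᵒᵖ M] (htau : TauTilting k C M)
    (h : ∀ N : Mdl Cᵐᵒᵖ, MemGen Cᵐᵒᵖ M N → ∀ β : M → E → N,
      (∀ m m' e, β (m + m') e = β m e + β m' e) → (∀ m e e', β m (e + e') = β m e + β m e') →
      (∀ m (a : C) e, β (op a • m) e = β m (a • e)) →
      (∀ m (a : C) e, β m (op a • e) = op a • β m e) → ∀ m e, β m e = 0)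
    (V : Type) [AddCommGroup V] (β : M → E → V)
    (h1 : ∀ m m' e, β (m + m') e = β m e + β m' e) (h2 : ∀ m e e', β m (e + e') = β m e + β m e')
    (h3 : ∀ m (a : C) e, β (op a • m) e = β m (a • e)) (m : M) (e : E) : β m e = 0 := by
  let U : Submodule Cᵐᵒᵖ (E ⊗[ℤ] M) :=
    Submodule.span Cᵐᵒᵖ (Set.range fun t : C × E × M => (t.1 • t.2.1) ⊗ₜ[ℤ] t.2.2 - t.2.1 ⊗ₜ[ℤ] (op t.1 • t.2.2))
  let X := (E ⊗[ℤ] M) ⧸ U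
  let γ : M → E → X := fun m e => U.mkQ (e ⊗ₜ m)
  have g1 : ∀ m m' e, γ (m + m') e = γ m e + γ m' e := fun m m' e => by
    simp only [γ, tmul_add, map_add]
  have g2 : ∀ m e e', γ m (e + e') = γ m e + γ m e' := fun m e e' => by
    simp only [γ, add_tmul, map_add]
  have g3 : ∀ m (a : C) e, γ (op a • m) e = γ m (a • e) := fun m a e => by
    apply Eq.symm
    apply (Submodule.Quotient.eq U).mpr
    exact Submodule.subset_span ⟨(a, e, m), rfl⟩
  have g4 : ∀ m (a : C) e, γ m (op a • e) = op a • γ m e := fun m a e => by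
    change U.mkQ ((op a • e) ⊗ₜ m) = op a • U.mkQ (e ⊗ₜ m)
    rw [← map_smul]; rfl
  have g0 : ∀ e, γ 0 e = 0 := fun e => by simp only [γ, tmul_zero, map_zero]
  -- γ spans
  have gspan : Submodule.span Cᵐᵒᵖ (Set.range fun t : M × E => γ t.1 t.2) = ⊤ := by
    rw [eq_top_iff]
    rintro x -
    obtain ⟨y, rfl⟩ := U.mkQ_surjective x
    induction y using TensorProduct.induction_on with
    | zero => rw [map_zero]; exact Submodule.zero_mem _
    | tmul e m => exact Submodule.subset_span ⟨(m, e), rfl⟩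
    | add a b ha hb => rw [map_add]; exact Submodule.add_mem _ ha hb
  have hX : Subsingleton X := by
    by_contra hX
    rw [not_subsingleton_iff_nontrivial] at hX
    have : Module.Finite Cᵐᵒᵖ X := by
      obtain ⟨n, s, hs⟩ := Module.Finite.exists_fin (R := Cᵐᵒᵖ) (M := M)
      let F : (Fin n → E) →ₗ[Cᵐᵒᵖ] X :=
        { toFun := fun v => ∑ j, γ (s j) (v j)
          map_add' := fun v w => by
            simp only [Pi.add_apply, g2, Finset.sum_add_distrib]
          map_smul' := fun c v => by
            obtain ⟨c⟩ := c
            simp only [Pi.smul_apply, RingHom.id_apply, Finset.smul_sum]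
            exact Finset.sum_congr rfl fun j _ => g4 _ _ _ }
      apply Module.Finite.of_surjective F
      rw [← LinearMap.range_eq_top, eq_top_iff, ← gspan, Submodule.span_le]
      rintro _ ⟨⟨m, e⟩, rfl⟩
      have hm : m ∈ Submodule.span Cᵐᵒᵖ (Set.range s) := by rw [hs]; trivial
      rw [Submodule.mem_span_range_iff_exists_fun] at hm
      obtain ⟨c, rfl⟩ := hm
      refine ⟨fun j => (c j).unop • e, ?_⟩
      change ∑ j, γ (s j) ((c j).unop • e) = γ (∑ j, c j • s j) e
      let γe : M →+ X := ⟨⟨fun m => γ m e, g0 e⟩, fun m m' => g1 m m' e⟩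
      change _ = γe (∑ j, c j • s j)
      rw [map_sum]
      exact Finset.sum_congr rfl fun j _ => (g3 _ _ _).symm
    obtain ⟨K, hK, -⟩ := (eq_top_or_exists_le_coatom (⊥ : Submodule Cᵐᵒᵖ X)).resolve_left bot_ne_top
    have hS : IsSimpleModule Cᵐᵒᵖ (X ⧸ K) := isSimpleModule_iff_isCoatom.mpr hK
    apply tauSincere k C M htau (ModuleCat.of Cᵐᵒᵖ (X ⧸ K)) hS
    intro W π hπ f
    by_contra hf
    have := h W ⟨1, π.comp (LinearMap.proj 0), fun w => by
      obtain ⟨m, rfl⟩ := hπ w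
      exact ⟨fun _ => m, rfl⟩⟩ (fun m e => f (K.mkQ (γ m e)))
      (fun m m' e => by simp only [g1, map_add])
      (fun m m' e => by simp only [g2, map_add])
      (fun m m' e => by rw [g3])
      (fun m a e => by rw [g4, map_smul]; exact map_smul f _ _)
    apply hf
    have h0 : (f : (X ⧸ K) →ₗ[Cᵐᵒᵖ] W).comp K.mkQ = 0 := by
      apply LinearMap.ext_on_range (v := fun t : M × E => γ t.1 t.2) gspan
      rintro ⟨m, e⟩
      exact this m e
    apply LinearMap.ext
    intro x
    obtain ⟨x, rfl⟩ := K.mkQ_surjective x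
    exact LinearMap.congr_fun h0 x
  have hU : e ⊗ₜ[ℤ] m ∈ U := by
    rw [← Submodule.Quotient.mk_eq_zero]
    exact Subsingleton.elim _ _
  have b0 : ∀ e, β 0 e = 0 := fun e => by
    have := h1 0 0 e; rw [add_zero] at this; exact left_eq_add.mp this
  have b0' : ∀ m, β m 0 = 0 := fun m => by
    have := h2 m 0 0; rw [add_zero] at this; exact left_eq_add.mp this
  let B : E ⊗[ℤ] M →+ V := TensorProduct.liftAddHom
    ⟨⟨fun e => ⟨⟨fun m => β m e, b0 e⟩, fun m m' => h1 m m' e⟩, by ext m; exact b0' m⟩,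
      fun e e' => by ext m; exact h2 m e e'⟩ (fun r e m => by
        change β m (r • e) = β (r • m) e
        let u : E →+ V := ⟨⟨fun e => β m e, b0' m⟩, fun e e' => h2 m e e'⟩
        let v : M →+ V := ⟨⟨fun m => β m e, b0 e⟩, fun m m' => h1 m m' e⟩
        exact (map_zsmul u r e).trans (map_zsmul v r m).symm)
  have hBt : ∀ e m, B (e ⊗ₜ m) = β m e := fun e m => rfl
  have hB : ∀ x ∈ U, ∀ c : Cᵐᵒᵖ, B (c • x) = 0 := by
    intro x hx
    induction hx using Submodule.span_induction with
    | mem x hx =>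
      obtain ⟨⟨a, e, m⟩, rfl⟩ := hx
      intro c
      change B (c • ((a • e) ⊗ₜ m - e ⊗ₜ (op a • m))) = 0
      rw [smul_sub, smul_tmul', smul_tmul', map_sub, hBt, hBt, h3, ← smul_comm, sub_self]
    | zero => intro c; rw [smul_zero]; exact map_zero B
    | add x y _ _ hx hy => intro c; rw [smul_add, map_add, hx, hy, add_zero]
    | smul a x _ hx => intro c; rw [smul_smul]; exact hx _
  have := hB _ hU 1
  rwa [one_smul, hBt] at this

theorem ext1Fac_of_balanced {A : Type} [Ring A] {P1 P0 M E : Type} [AddCommGroup P1] [Module Aᵐᵒᵖ P1]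
    [AddCommGroup P0] [Module Aᵐᵒᵖ P0]
    [Module.Finite Aᵐᵒᵖ P1] [Module.Projective Aᵐᵒᵖ P1]
    [AddCommGroup M] [Module Aᵐᵒᵖ M] [AddCommGroup E] [Module A E]
    (d1 : P1 →ₗ[Aᵐᵒᵖ] P0) (q : (P1 →ₗ[Aᵐᵒᵖ] A) →ₗ[A] E) (hq : Function.Surjective q)
    (hq0 : ∀ g : P1 →ₗ[Aᵐᵒᵖ] A, q g = 0 → ∃ f : P0 →ₗ[Aᵐᵒᵖ] A, g = f.comp d1)
    (hbal : ∀ (V : Type) [AddCommGroup V] (β : M → E → V),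
      (∀ m m' e, β (m + m') e = β m e + β m' e) → (∀ m e e', β m (e + e') = β m e + β m e') →
      (∀ m (a : A) e, β (op a • m) e = β m (a • e)) → ∀ m e, β m e = 0) : Ext1Fac d1 M := by
  let I : AddSubgroup (P1 →ₗ[Aᵐᵒᵖ] M) :=
    { carrier := {u | ∃ h : P0 →ₗ[Aᵐᵒᵖ] M, u = h.comp d1}
      zero_mem' := ⟨0, by simp⟩
      add_mem' := by
        rintro _ _ ⟨f, rfl⟩ ⟨g, rfl⟩
        exact ⟨f + g, by rw [LinearMap.add_comp]⟩
      neg_mem' := by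
        rintro _ ⟨f, rfl⟩
        exact ⟨-f, by rw [LinearMap.neg_comp]⟩ }
  have hI : ∀ m (g : P1 →ₗ[Aᵐᵒᵖ] A), q g = 0 → smulHom m g ∈ I := by
    intro m g hg
    obtain ⟨f, rfl⟩ := hq0 g hg
    exact ⟨smulHom m f, rfl⟩
  have key : ∀ m (g g' : P1 →ₗ[Aᵐᵒᵖ] A), q g = q g' →
      (QuotientAddGroup.mk' I) (smulHom m g) = (QuotientAddGroup.mk' I) (smulHom m g') := by
    intro m g g' hg
    rw [← sub_eq_zero, ← map_sub]
    have h1 : smulHom m g - smulHom m g' = smulHom m (g - g') := by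
      ext p; simp [smulHom_apply, sub_smul]
    rw [h1]
    exact (QuotientAddGroup.eq_zero_iff _).mpr (hI m _ (by rw [map_sub, hg, sub_self]))
  let σ : E → (P1 →ₗ[Aᵐᵒᵖ] A) := Function.surjInv hq
  have hσ : ∀ e, q (σ e) = e := Function.surjInv_eq hq
  have h0 := hbal _ (fun m e => (QuotientAddGroup.mk' I) (smulHom m (σ e)))
    (fun m m' e => by
      rw [← map_add]; congr 1; ext p; simp [smulHom_apply])
    (fun m e e' => by
      rw [← map_add]
      have h1 : smulHom m (σ e) + smulHom m (σ e') = smulHom m (σ e + σ e') := by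
        ext p; simp [smulHom_apply, add_smul]
      rw [h1]
      exact key m _ _ (by rw [map_add, hσ, hσ, hσ]))
    (fun m a e => by
      have h1 : smulHom (op a • m) (σ e) = smulHom m (a • σ e) := by
        ext p; simp [smulHom_apply, smul_smul]
      change (QuotientAddGroup.mk' I) (smulHom (op a • m) (σ e)) = _
      rw [h1]
      exact key m _ _ (by rw [map_smul, hσ, hσ]))
  have h2 : ∀ m g, smulHom m g ∈ I := by
    intro m g
    rw [← QuotientAddGroup.eq_zero_iff]
    exact (key m g (σ (q g)) (hσ _).symm).trans (h0 m (q g))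
  intro u
  obtain ⟨n, y, ys, hy⟩ := exists_dualBasis (A := A) P1
  have h3 : u ∈ I := by
    rw [eq_sum_smulHom y ys hy u]
    exact I.sum_mem fun i _ => h2 _ _
  exact h3
end Tens

section GlDim

theorem projective_sub {R : Type} [Ring R] (hh : ∀ N : ModuleCat.{0} R, PdLE1 R N) {P : Type}
    [AddCommGroup P] [Module R P] [Module.Projective R P] (Q : Submodule R P) : Module.Projective R Q := by
  obtain ⟨P1, P0, d1, d0, hp1, hp0, hd1, hd0, hd⟩ := hh (ModuleCat.of R (P ⧸ Q))
  obtain ⟨f, hf⟩ := Module.projective_lifting_property d0 (Q.mkQ : P →ₗ[R] (P ⧸ Q)) hd0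
  obtain ⟨t, ht⟩ := Module.projective_lifting_property (Q.mkQ : P →ₗ[R] (P ⧸ Q)) d0 Q.mkQ_surjective
  have hf' : ∀ x, d0 (f x) = Q.mkQ x := fun x => LinearMap.congr_fun hf x
  have ht' : ∀ x, Q.mkQ (t x) = d0 x := fun x => LinearMap.congr_fun ht x
  obtain ⟨g, hg⟩ := exists_factor d1 hd1 (f.comp Q.subtype) (fun y => by
    rw [hd]
    change d0 (f y) = 0
    rw [hf']
    exact (Submodule.Quotient.mk_eq_zero Q).mpr y.2)
  have hg' : ∀ y : Q, d1 (g y) = f y := hg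
  let i : Q →ₗ[R] (P × P1) := LinearMap.prod Q.subtype (-g)
  let s : (P × P1) →ₗ[R] Q := LinearMap.codRestrict Q
    (LinearMap.fst R P P1 - t.comp (f.comp (LinearMap.fst R P P1) + d1.comp (LinearMap.snd R P P1)))
    (fun x => by
      rw [← Submodule.Quotient.mk_eq_zero]
      change Q.mkQ (x.1 - t (f x.1 + d1 x.2)) = 0
      rw [map_sub, ht', map_add, hf']
      have : d0 (d1 x.2) = 0 := by
        have : d1 x.2 ∈ LinearMap.ker d0 := by rw [← hd]; exact ⟨_, rfl⟩
        exact this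
      rw [this, add_zero, sub_self])
  apply Module.Projective.of_split i s
  ext q
  change (q : P) - t (f q + d1 (-g q)) = q
  rw [map_neg, hg', add_neg_cancel, map_zero, sub_zero]

theorem ker_projective {Λ : Type} [Ring Λ] (hh : ∀ N : ModuleCat.{0} Λ, PdLE1 Λ N)
    (T : ModuleCat.{0} Λ) (hT : Ext1Zero Λ T T) {C : Type} [Ring C] [IsNoetherianRing Cᵐᵒᵖ]
    (ε : C ≃+* Module.End Λ T) {m n : ℕ} (Φ : (Fin m → C) →ₗ[Cᵐᵒᵖ] (Fin n → C)) :
    Module.Projective Cᵐᵒᵖ (LinearMap.ker Φ) := by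
  classical
  obtain ⟨Q1, Q0, d1, d0, hp1, hp0, hd1, hd0, hd⟩ := hh T
  have hd' : ∀ x, d0 (d1 x) = 0 := fun x => by
    have : d1 x ∈ LinearMap.ker d0 := by rw [← hd]; exact ⟨_, rfl⟩
    exact this
  -- hat
  let hat : ∀ {r : ℕ}, (Fin r → C) → (T →ₗ[Λ] (Fin r → T)) := fun z => LinearMap.pi fun i => ε (z i)
  have hat_apply : ∀ {r : ℕ} (z : Fin r → C) t i, hat z t i = ε (z i) t := fun z t i => rfl
  have hat_smul : ∀ {r : ℕ} (z : Fin r → C) (c : C) t, hat (op c • z) t = hat z (ε c t) := by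
    intro r z c t
    ext i
    rw [hat_apply, hat_apply]
    change ε (z i * c) t = _
    rw [map_mul]; rfl
  have hat_sum : ∀ {r l : ℕ} (z : Fin l → Fin r → C) t, hat (∑ j, z j) t = ∑ j, hat (z j) t := by
    intro r l z t
    ext i
    rw [hat_apply, Finset.sum_apply, map_sum, LinearMap.sum_apply, Finset.sum_apply]
    rfl
  have hat_inj : ∀ {r : ℕ} (z z' : Fin r → C), (∀ t, hat z t = hat z' t) → z = z' := by
    intro r z z' h
    ext i
    apply ε.injective
    ext t
    exact congr_fun (h t) i
  have hat_zero : ∀ {r : ℕ} t, hat (0 : Fin r → C) t = 0 := by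
    intro r t; ext i; rw [hat_apply, Pi.zero_apply, map_zero]; rfl
  -- Φ hat
  let Φh : (Fin m → T) →ₗ[Λ] (Fin n → T) := ∑ j, (hat (Φ (Pi.single j 1))).comp (LinearMap.proj j)
  have hsum : ∀ z : Fin m → C, z = ∑ j, op (z j) • (Pi.single j 1 : Fin m → C) := by
    intro z; ext i; simp [Pi.single_apply]
  have hΦ : ∀ z t, Φh (hat z t) = hat (Φ z) t := by
    intro z t
    conv_rhs => rw [hsum z, map_sum]
    rw [hat_sum]
    simp only [Φh, LinearMap.sum_apply]
    apply Finset.sum_congr rfl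
    intro j _
    rw [map_smul, hat_smul]; rfl
  -- generators of Z
  have hfg : Module.Finite Cᵐᵒᵖ (LinearMap.ker Φ) := by
    have : Module.Finite Cᵐᵒᵖ C := Module.Finite.of_surjective (unopLin C) (fun x => ⟨op x, rfl⟩)
    infer_instance
  obtain ⟨d, z, hz⟩ := Module.Finite.exists_fin (R := Cᵐᵒᵖ) (M := LinearMap.ker Φ)
  have hzs : ∀ x : LinearMap.ker Φ, ∃ c : Fin d → C, x = ∑ l, op (c l) • z l := by
    intro x
    have hx : x ∈ Submodule.span Cᵐᵒᵖ (Set.range z) := by rw [hz]; trivial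
    rw [Submodule.mem_span_range_iff_exists_fun] at hx
    obtain ⟨c, hc⟩ := hx
    exact ⟨fun l => (c l).unop, hc.symm⟩
  let G : (Fin d → T) →ₗ[Λ] (Fin m → T) := ∑ l, (hat (z l : Fin m → C)).comp (LinearMap.proj l)
  have hG : ∀ x, G x = ∑ l, hat (z l : Fin m → C) (x l) := fun x => by
    simp only [G, LinearMap.sum_apply]; rfl
  have hGhat : ∀ (c : Fin d → C) t, G (hat c t) = hat (∑ l, op (c l) • (z l : Fin m → C)) t := by
    intro c t
    rw [hG, hat_sum]
    exact Finset.sum_congr rfl fun l _ => (hat_smul _ _ _).symm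
  have hΦG : ∀ x, Φh (G x) = 0 := by
    intro x
    rw [hG, map_sum]
    apply Finset.sum_eq_zero
    intro l _
    rw [hΦ, (z l).2, hat_zero]
  have surj_hat : ∀ {r : ℕ} (a : T →ₗ[Λ] (Fin r → T)), ∃ c : Fin r → C, ∀ t, hat c t = a t := by
    intro r a
    refine ⟨fun i => ε.symm ((LinearMap.proj i).comp a), fun t => ?_⟩
    ext i
    rw [hat_apply, RingEquiv.apply_symm_apply]; rfl
  -- extension of maps Q1 → T^d
  have ext1 : ∀ u : Q1 →ₗ[Λ] T, ∃ w : Q0 →ₗ[Λ] T, ∀ x, w (d1 x) = u x := by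
    intro u
    let e : Q1 ≃ₗ[Λ] LinearMap.ker d0 := (LinearEquiv.ofInjective d1 hd1).trans (LinearEquiv.ofEq _ _ hd)
    obtain ⟨w, hw⟩ := extend_of_ext1Zero hT d0 hd0 (u.comp e.symm.toLinearMap)
    refine ⟨w, fun x => ?_⟩
    have := hw (e x)
    rw [LinearMap.comp_apply, LinearEquiv.coe_coe, LinearEquiv.symm_apply_apply] at this
    exact this
  have extL : ∀ u : Q1 →ₗ[Λ] (Fin d → T), (∀ x, G (u x) = 0) →
      ∃ w : Q0 →ₗ[Λ] (Fin d → T), (∀ x, w (d1 x) = u x) ∧ ∀ y, G (w y) = 0 := by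
    intro u hu
    choose w hw using fun l => ext1 ((LinearMap.proj l).comp u)
    let w0 : Q0 →ₗ[Λ] (Fin d → T) := LinearMap.pi w
    have hw0 : ∀ x, w0 (d1 x) = u x := fun x => by ext l; exact hw l x
    obtain ⟨a, ha⟩ := exists_descend d0 hd0 (G.comp w0) (fun x hx => by
      have : x ∈ LinearMap.range d1 := by rw [hd]; exact hx
      obtain ⟨y, rfl⟩ := this
      rw [LinearMap.comp_apply, hw0, hu])
    obtain ⟨b, hb⟩ := surj_hat a
    have hbZ : b ∈ LinearMap.ker Φ := by
      apply hat_inj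
      intro t
      obtain ⟨y, rfl⟩ := hd0 t
      rw [← hΦ, hb, ha, hat_zero]
      exact hΦG _
    obtain ⟨c, hc⟩ := hzs ⟨b, hbZ⟩
    have hc' : b = ∑ l, op (c l) • (z l : Fin m → C) := by
      have := congr_arg Subtype.val hc
      simpa using this
    refine ⟨w0 - (hat c).comp d0, fun x => ?_, fun y => ?_⟩
    · rw [LinearMap.sub_apply, LinearMap.comp_apply, hd', map_zero, sub_zero, hw0]
    · rw [LinearMap.sub_apply, LinearMap.comp_apply, map_sub, hGhat, ← hc', hb, ha, LinearMap.comp_apply, sub_self]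
  -- section of G
  let V := LinearMap.range G
  let D0 : (Fin m → Q0) →ₗ[Λ] (Fin m → T) := LinearMap.pi fun i => d0.comp (LinearMap.proj i)
  have hD0 : Function.Surjective D0 := fun t => by
    choose x hx using fun i => hd0 (t i)
    exact ⟨x, funext hx⟩
  let Q' : Submodule Λ (Fin m → Q0) := V.comap D0
  have hQ0m : Module.Projective Λ (Fin m → Q0) := projective_pi_fin _
  have hQ' : Module.Projective Λ Q' := projective_sub hh Q'
  let E0 : Q' →ₗ[Λ] V := LinearMap.codRestrict V (D0.comp Q'.subtype) (fun x => x.2)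
  have hE0 : Function.Surjective E0 := by
    rintro ⟨v, hv⟩
    obtain ⟨x, rfl⟩ := hD0 v
    exact ⟨⟨x, hv⟩, rfl⟩
  obtain ⟨lam, hlam⟩ := Module.projective_lifting_property G.rangeRestrict E0 G.surjective_rangeRestrict
  have hlam' : ∀ x : Q', G (lam x) = D0 x := fun x => congr_arg Subtype.val (LinearMap.congr_fun hlam x)
  let j : Fin m → (Q1 →ₗ[Λ] Q') := fun i => LinearMap.codRestrict Q' ((LinearMap.single Λ (fun _ => Q0) i).comp d1)
    (fun x => by
      have : D0 (Pi.single i (d1 x)) = 0 := by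
        ext i'
        change d0 (Pi.single (M := fun _ => Q0) i (d1 x) i') = 0
        by_cases h : i' = i
        · subst h; rw [Pi.single_eq_same, hd']
        · rw [Pi.single_eq_of_ne h, map_zero]
      change D0 (Pi.single i (d1 x)) ∈ V
      rw [this]; exact V.zero_mem)
  have hjv : ∀ i x, (j i x : Fin m → Q0) = Pi.single i (d1 x) := fun i x => rfl
  have hjD : ∀ i x, D0 (j i x) = 0 := fun i x => by
    ext i'
    change d0 (Pi.single (M := fun _ => Q0) i (d1 x) i') = 0
    by_cases h : i' = i
    · subst h; rw [Pi.single_eq_same, hd']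
    · rw [Pi.single_eq_of_ne h, map_zero]
  choose ρ hρ1 hρ2 using fun i => extL (lam.comp (j i)) (fun x => by
    rw [LinearMap.comp_apply, hlam', hjD])
  let R : (Fin m → Q0) →ₗ[Λ] (Fin d → T) := ∑ i, (ρ i).comp (LinearMap.proj i)
  have hR : ∀ x, R x = ∑ i, ρ i (x i) := fun x => by
    simp only [R, LinearMap.sum_apply]; rfl
  have hGR : ∀ x, G (R x) = 0 := fun x => by
    rw [hR, map_sum]; exact Finset.sum_eq_zero fun i _ => hρ2 i _
  let lam' : Q' →ₗ[Λ] (Fin d → T) := lam - R.comp Q'.subtype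
  obtain ⟨s, hs⟩ := exists_descend E0 hE0 lam' (fun x hx => by
    have hx' : ∀ i, d0 ((x : Fin m → Q0) i) = 0 := fun i => congr_fun (congr_arg Subtype.val hx) i
    have hx2 : ∀ i, ∃ y, d1 y = (x : Fin m → Q0) i := fun i => by
      have : (x : Fin m → Q0) i ∈ LinearMap.range d1 := by rw [hd]; exact hx' i
      exact this
    choose y hy using hx2
    have hxs : x = ∑ i, j i (y i) := by
      apply Subtype.ext
      rw [Submodule.coe_sum]
      ext i
      simp only [hjv, hy]
      rw [Finset.univ_sum_single]
    change lam x - R x = 0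
    rw [hR]
    conv_lhs => rw [hxs, map_sum]
    rw [← hxs, sub_eq_zero]
    exact Finset.sum_congr rfl fun i _ => by rw [← hy, hρ1]; rfl)
  have hGs : ∀ v : V, G (s v) = v := by
    intro v
    obtain ⟨x, rfl⟩ := hE0 v
    rw [hs]
    change G (lam x - R x) = D0 x
    rw [map_sub, hGR, sub_zero, hlam']
  have hzV : ∀ (x : LinearMap.ker Φ) t, hat (x : Fin m → C) t ∈ V := by
    intro x t
    obtain ⟨c, hc⟩ := hzs x
    refine ⟨hat c t, ?_⟩
    rw [hGhat, hc]
    simp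
  -- section of C^d → Z
  let sz : LinearMap.ker Φ → (T →ₗ[Λ] (Fin d → T)) := fun x =>
    s.comp (LinearMap.codRestrict V (hat (x : Fin m → C)) (hzV x))
  have hsz : ∀ x t, sz x t = s ⟨hat (x : Fin m → C) t, hzV x t⟩ := fun x t => rfl
  choose σ hσ using fun x => surj_hat (sz x)
  let S : LinearMap.ker Φ →ₗ[Cᵐᵒᵖ] (Fin d → C) :=
    { toFun := σ
      map_add' := fun x y => by
        apply hat_inj
        intro t
        have h1 : hat (σ x + σ y) t = hat (σ x) t + hat (σ y) t := by
          ext i; rw [hat_apply, Pi.add_apply, map_add]; rfl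
        rw [h1, hσ, hσ, hσ, hsz, hsz, hsz, ← map_add]
        congr 1
        apply Subtype.ext
        ext i
        change ε (_ + _) t = _
        rw [map_add]; rfl
      map_smul' := fun c x => by
        obtain ⟨c⟩ := c
        apply hat_inj
        intro t
        change hat (σ (op c • x)) t = hat (op c • σ x) t
        rw [hat_smul, hσ, hσ, hsz, hsz]
        congr 1
        apply Subtype.ext
        exact hat_smul _ _ _ }
  let Pz : (Fin d → C) →ₗ[Cᵐᵒᵖ] LinearMap.ker Φ :=
    { toFun := fun c => ∑ l, op (c l) • z l
      map_add' := fun x y => by simp [add_smul, Finset.sum_add_distrib]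
      map_smul' := fun c x => by
        obtain ⟨c⟩ := c
        simp only [Pi.smul_apply, RingHom.id_apply, Finset.smul_sum, smul_smul]
        rfl }
  have hCp : Module.Projective Cᵐᵒᵖ C := Module.Projective.of_equiv
    (LinearEquiv.ofBijective (unopLin C) ⟨fun x y h => MulOpposite.unop_injective h, fun x => ⟨op x, rfl⟩⟩)
  have hCd : Module.Projective Cᵐᵒᵖ (Fin d → C) := projective_pi_fin _
  apply Module.Projective.of_split S Pz
  apply LinearMap.ext
  intro x
  apply Subtype.ext
  apply hat_inj
  intro t
  have h1 : ((Pz (S x) : LinearMap.ker Φ) : Fin m → C) = ∑ l, op (σ x l) • (z l : Fin m → C) := by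
    change ((∑ l, op (σ x l) • z l : LinearMap.ker Φ) : Fin m → C) = _
    simp
  change hat ((Pz (S x) : LinearMap.ker Φ) : Fin m → C) t = _
  rw [h1, ← hGhat, hσ, hsz, hGs]
  rfl
end GlDim

section IdOne

theorem exists_injHull {R : Type} [Ring R] (M : ModuleCat.{0} R) : ∃ (I0 : ModuleCat.{0} R) (i : M →ₗ[R] I0),
    Module.Injective R I0 ∧ Function.Injective i := by
  have : EnoughInjectives (ModuleCat.{0} R) := ModuleCat.enoughInjectives.{0} R
  refine ⟨Injective.under M, (Injective.ι M).hom, ?_, ?_⟩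
  · rw [Module.injective_iff_injective_object]
    exact (inferInstance : Injective (Injective.under M))
  · exact (ModuleCat.mono_iff_injective _).mp inferInstance

theorem idLE1_of_ext2 (k : Type) [Field k] {C : Type} [Ring C] [Algebra k C] [FiniteDimensional k C]
    (hker : ∀ (m n : ℕ) (Φ : (Fin m → C) →ₗ[Cᵐᵒᵖ] (Fin n → C)), Module.Projective Cᵐᵒᵖ (LinearMap.ker Φ))
    {DC : ModuleCat.{0} Cᵐᵒᵖ} (hDC : IsDC k C DC)
    {P2 P1 P0 : ModuleCat.{0} Cᵐᵒᵖ} (d2 : P2 →ₗ[Cᵐᵒᵖ] P1) (d1 : P1 →ₗ[Cᵐᵒᵖ] P0) (d0 : P0 →ₗ[Cᵐᵒᵖ] DC)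
    [Module.Projective Cᵐᵒᵖ P1] [Module.Projective Cᵐᵒᵖ P0] [Module.Finite Cᵐᵒᵖ P0]
    (hd0 : Function.Surjective d0) (hd21 : LinearMap.range d2 = LinearMap.ker d1)
    (hd10 : LinearMap.range d1 = LinearMap.ker d0)
    (M : ModuleCat.{0} Cᵐᵒᵖ) (hM : Ext1Fac d2 M) : IdLE1 Cᵐᵒᵖ M := by
  classical
  have : IsArtinianRing Cᵐᵒᵖ := isArtinianRing_op k C
  obtain ⟨I0, i, hI0, hi⟩ := exists_injHull M
  let N := LinearMap.range i
  let π : I0 →ₗ[Cᵐᵒᵖ] (I0 ⧸ N) := N.mkQ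
  have hπ : Function.Surjective π := N.mkQ_surjective
  have hπ0 : ∀ x, π x = 0 ↔ x ∈ N := fun x => Submodule.Quotient.mk_eq_zero N
  refine ⟨I0, ModuleCat.of _ (I0 ⧸ N), i, π, hI0, ?_, hi, hπ, (Submodule.ker_mkQ N).symm⟩
  have d10 : ∀ x, d0 (d1 x) = 0 := fun x => by
    have : d1 x ∈ LinearMap.ker d0 := hd10 ▸ ⟨x, rfl⟩
    exact this
  have d21 : ∀ x, d1 (d2 x) = 0 := fun x => by
    have : d2 x ∈ LinearMap.ker d1 := hd21 ▸ ⟨x, rfl⟩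
    exact this
  -- (a)
  have ha : ∀ u : LinearMap.ker d0 →ₗ[Cᵐᵒᵖ] (I0 ⧸ N), ∃ w : P0 →ₗ[Cᵐᵒᵖ] (I0 ⧸ N), ∀ x : LinearMap.ker d0, w x = u x := by
    intro u
    let d1' : P1 →ₗ[Cᵐᵒᵖ] LinearMap.ker d0 := LinearMap.codRestrict _ d1 d10
    have hd1' : ∀ x, d1' x = 0 ↔ d1 x = 0 := fun x =>
      ⟨fun h => congr_arg Subtype.val h, fun h => Subtype.ext h⟩
    have hd1s : Function.Surjective d1' := by
      rintro ⟨x, hx⟩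
      rw [← hd10] at hx
      obtain ⟨y, rfl⟩ := hx
      exact ⟨y, rfl⟩
    obtain ⟨v, hv⟩ := Module.projective_lifting_property π (u.comp d1') hπ
    have hv' : ∀ x, π (v x) = u (d1' x) := fun x => LinearMap.congr_fun hv x
    obtain ⟨g, hg⟩ := exists_factor i hi (v.comp d2) (fun x => by
      rw [← hπ0, LinearMap.comp_apply, hv', (hd1' _).mpr (d21 x), map_zero])
    obtain ⟨h, hh⟩ := hM g
    obtain ⟨t, ht⟩ := exists_descend d1' hd1s (v - i.comp h) (fun x hx => by
      have : x ∈ LinearMap.range d2 := by rw [hd21]; exact (hd1' x).mp hx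
      obtain ⟨y, rfl⟩ := this
      have h1 := hg y
      rw [hh] at h1
      rw [LinearMap.sub_apply, sub_eq_zero]
      exact h1.symm)
    obtain ⟨w, hw⟩ := hI0.out (LinearMap.ker d0).subtype (Submodule.subtype_injective _) t
    refine ⟨π.comp w, fun x => ?_⟩
    obtain ⟨y, rfl⟩ := hd1s x
    have h1 : w (d1' y) = v y - i (h y) := (hw (d1' y)).trans (ht y)
    rw [LinearMap.comp_apply, h1, map_sub, hv', (hπ0 (i (h y))).mpr ⟨_, rfl⟩, sub_zero]
  apply Module.Baer.injective
  intro J f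
  obtain ⟨r, e, he⟩ := hDC.embed k (Cᵐᵒᵖ ⧸ J)
  let D0 : (Fin r → P0) →ₗ[Cᵐᵒᵖ] (Fin r → DC) := LinearMap.pi fun l => d0.comp (LinearMap.proj l)
  have hD0 : Function.Surjective D0 := fun t => by
    choose x hx using fun l => hd0 (t l)
    exact ⟨x, funext hx⟩
  let K : Submodule Cᵐᵒᵖ (Fin r → P0) := (LinearMap.range e).comap D0
  obtain ⟨κ, hκ⟩ := exists_factor e he (D0.comp K.subtype) (fun x => x.2)
  have hκs : Function.Surjective κ := by
    intro x
    obtain ⟨y, hy⟩ := hD0 (e x)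
    refine ⟨⟨y, by change D0 y ∈ LinearMap.range e; rw [hy]; exact ⟨x, rfl⟩⟩, he ?_⟩
    rw [hκ]; exact hy
  have hCp : Module.Projective Cᵐᵒᵖ C := Module.Projective.of_equiv
    (LinearEquiv.ofBijective (unopLin C) ⟨fun x y h => MulOpposite.unop_injective h, fun x => ⟨op x, rfl⟩⟩)
  -- presentation of K
  obtain ⟨m, s, hs⟩ := Module.Finite.exists_fin (R := Cᵐᵒᵖ) (M := K)
  let p : (Fin m → C) →ₗ[Cᵐᵒᵖ] K :=
    { toFun := fun c => ∑ l, op (c l) • s l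
      map_add' := fun x y => by simp [add_smul, Finset.sum_add_distrib]
      map_smul' := fun c x => by
        obtain ⟨c⟩ := c
        simp only [Pi.smul_apply, RingHom.id_apply, Finset.smul_sum, smul_smul]
        rfl }
  have hp : Function.Surjective p := by
    intro x
    have hx : x ∈ Submodule.span Cᵐᵒᵖ (Set.range s) := by rw [hs]; trivial
    rw [Submodule.mem_span_range_iff_exists_fun] at hx
    obtain ⟨c, hc⟩ := hx
    exact ⟨fun l => (c l).unop, hc⟩
  have hCm : Module.Projective Cᵐᵒᵖ (Fin m → C) := projective_pi_fin _
  have hPr : Module.Projective Cᵐᵒᵖ (Fin r → P0) := projective_pi_fin _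
  obtain ⟨n, y, ys, hy⟩ := exists_dualBasis (A := C) (Fin r → P0)
  let ι : (Fin r → P0) →ₗ[Cᵐᵒᵖ] (Fin n → C) := LinearMap.pi ys
  have hι : Function.Injective ι := by
    rw [← LinearMap.ker_eq_bot, LinearMap.ker_eq_bot']
    intro x hx
    rw [hy x]
    apply Finset.sum_eq_zero
    intro l _
    have : ys l x = 0 := congr_fun hx l
    rw [this, MulOpposite.op_zero, zero_smul]
  have hZ : Module.Projective Cᵐᵒᵖ (LinearMap.ker p) := by
    have h1 := hker m n (ι.comp (K.subtype.comp p))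
    have h2 : LinearMap.ker (ι.comp (K.subtype.comp p)) = LinearMap.ker p := by
      ext x
      constructor
      · intro hx
        exact Subtype.ext (hι ((show ι (p x) = 0 from hx).trans (map_zero ι).symm))
      · intro hx
        change ι (p x : Fin r → P0) = 0
        rw [show p x = 0 from hx]
        exact map_zero ι
    rwa [h2] at h1
  have hK : Ext1Fac (LinearMap.ker p).subtype (I0 ⧸ N) := by
    intro u
    obtain ⟨v, hv⟩ := Module.projective_lifting_property π u hπ
    obtain ⟨w, hw⟩ := hI0.out (LinearMap.ker p).subtype (Submodule.subtype_injective _) v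
    refine ⟨π.comp w, ?_⟩
    ext x
    rw [← hv]
    exact congr_arg π (hw x).symm
  -- Ext1Zero
  have hX : Ext1Zero Cᵐᵒᵖ (ModuleCat.of Cᵐᵒᵖ (Cᵐᵒᵖ ⧸ J)) (ModuleCat.of Cᵐᵒᵖ (I0 ⧸ N)) := by
    intro W a b hab hb hE
    have hba : ∀ x, b (a x) = 0 := fun x => by
      have : a x ∈ LinearMap.ker b := hE ▸ ⟨x, rfl⟩
      exact this
    obtain ⟨w, hw⟩ := lift_of_ext1Fac (LinearMap.ker p).subtype p hp (Submodule.range_subtype _) a b hab hb hE hK κ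
    have hw' : ∀ x, b (w x) = κ x := fun x => LinearMap.congr_fun hw x
    -- embed ker d0 in K in coordinate l
    let j : Fin r → (LinearMap.ker d0 →ₗ[Cᵐᵒᵖ] K) := fun l =>
      LinearMap.codRestrict K ((LinearMap.single Cᵐᵒᵖ (fun _ => P0) l).comp (LinearMap.ker d0).subtype)
      (fun x => by
        have : D0 (Pi.single l (x : P0)) = 0 := by
          ext i'
          change d0 (Pi.single (M := fun _ => P0) l (x : P0) i') = 0
          by_cases h : i' = l
          · subst h; rw [Pi.single_eq_same]; exact x.2
          · rw [Pi.single_eq_of_ne h, map_zero]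
        change D0 (Pi.single l (x : P0)) ∈ LinearMap.range e
        rw [this]; exact Submodule.zero_mem _)
    have hjv : ∀ l x, (j l x : Fin r → P0) = Pi.single l (x : P0) := fun l x => rfl
    have hjκ : ∀ l x, κ (j l x) = 0 := fun l x => by
      apply he
      rw [hκ, map_zero]
      ext i'
      change d0 (Pi.single (M := fun _ => P0) l (x : P0) i') = 0
      by_cases h : i' = l
      · subst h; rw [Pi.single_eq_same]; exact x.2
      · rw [Pi.single_eq_of_ne h, map_zero]
    choose u hu using fun l => exists_factor a hab (w.comp (j l)) (fun x => by
      rw [hE]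
      change b (w (j l x)) = 0
      rw [hw', hjκ])
    choose v hv using fun l => ha (u l)
    let R : (Fin r → P0) →ₗ[Cᵐᵒᵖ] (I0 ⧸ N) := ∑ l, (v l).comp (LinearMap.proj l)
    have hR : ∀ x, R x = ∑ l, v l (x l) := fun x => by
      simp only [R, LinearMap.sum_apply]; rfl
    obtain ⟨t, ht⟩ := exists_descend κ hκs (w - a.comp (R.comp K.subtype)) (fun x hx => by
      have hx0 : D0 (x : Fin r → P0) = 0 := by
        have := hκ x
        rw [hx, map_zero] at this
        exact this.symm
      have hx' : ∀ l, (x : Fin r → P0) l ∈ LinearMap.ker d0 := fun l => congr_fun hx0 l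
      have hxs : x = ∑ l, j l ⟨_, hx' l⟩ := by
        apply Subtype.ext
        rw [Submodule.coe_sum]
        simp only [hjv]
        rw [Finset.univ_sum_single]
      change w x - a (R x) = 0
      rw [hR]
      conv_lhs => rw [hxs, map_sum]
      rw [← hxs, sub_eq_zero]
      refine Eq.trans ?_ (map_sum a _ _).symm
      exact Finset.sum_congr rfl fun l _ => by
        rw [hv l ⟨_, hx' l⟩, hu]; rfl)
    refine ⟨t, ?_⟩
    apply LinearMap.ext
    intro x
    obtain ⟨y, rfl⟩ := hκs x
    change b (t (κ y)) = κ y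
    rw [ht]
    change b (w y - a (R y)) = κ y
    rw [map_sub, hba, sub_zero, hw']
  obtain ⟨w, hw⟩ := extend_of_ext1Zero hX (J.mkQ : Cᵐᵒᵖ →ₗ[Cᵐᵒᵖ] (Cᵐᵒᵖ ⧸ J)) J.mkQ_surjective
    (f.comp (LinearEquiv.ofEq _ _ (Submodule.ker_mkQ J)).toLinearMap)
  refine ⟨w, fun x hx => ?_⟩
  exact hw ⟨x, by rw [Submodule.ker_mkQ]; exact hx⟩
end IdOne

section Asm

variable {C : Type} [Ring C] {E : Type} [AddCommGroup E]
  [Module C E] [Module Cᵐᵒᵖ E] [SMulCommClass C Cᵐᵒᵖ E]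

theorem modB_inl_smul (M : Mdl Cᵐᵒᵖ) (c : C) (m : modB C E M) :
    op (TrivSqZeroExt.inl c : TrivSqZeroExt C E) • m = (show modB C E M from (op c • (show M from m) : M)) := rfl

/-- submodules of `M` over `C` and over `B` agree -/
def modBSub (M : Mdl Cᵐᵒᵖ) : Submodule (TrivSqZeroExt C E)ᵐᵒᵖ (modB C E M) ≃o Submodule Cᵐᵒᵖ M where
  toFun U :=
    { carrier := {m : M | (show modB C E M from m) ∈ U}
      zero_mem' := U.zero_mem
      add_mem' := fun ha hb => U.add_mem ha hb
      smul_mem' := fun c x hx => U.smul_mem (op (TrivSqZeroExt.inl c.unop)) hx }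
  invFun U :=
    { carrier := {m : modB C E M | (show M from m) ∈ U}
      zero_mem' := U.zero_mem
      add_mem' := fun ha hb => U.add_mem ha hb
      smul_mem' := fun c x hx => U.smul_mem (op c.unop.fst) hx }
  left_inv U := rfl
  right_inv U := rfl
  map_rel_iff' := Iff.rfl

def modBMap {M N : Mdl Cᵐᵒᵖ} (f : M →ₗ[Cᵐᵒᵖ] N) :
    modB C E M →ₗ[(TrivSqZeroExt C E)ᵐᵒᵖ] modB C E N where
  toFun := fun x => f x
  map_add' := fun x y => f.map_add x y
  map_smul' := fun c x => f.map_smul (op c.unop.fst) x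

def modBEquiv {M N : Mdl Cᵐᵒᵖ} (f : M ≃ₗ[Cᵐᵒᵖ] N) :
    modB C E M ≃ₗ[(TrivSqZeroExt C E)ᵐᵒᵖ] modB C E N where
  toFun := fun x => f x
  invFun := fun x => f.symm x
  left_inv := f.left_inv
  right_inv := f.right_inv
  map_add' := fun x y => f.map_add x y
  map_smul' := fun c x => f.map_smul (op c.unop.fst) x

def unmodBEquiv {M N : Mdl Cᵐᵒᵖ} (f : modB C E M ≃ₗ[(TrivSqZeroExt C E)ᵐᵒᵖ] modB C E N) :
    M ≃ₗ[Cᵐᵒᵖ] N where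
  toFun := fun x => f x
  invFun := fun x => f.symm x
  left_inv := f.left_inv
  right_inv := f.right_inv
  map_add' := fun x y => f.map_add x y
  map_smul' := fun c x => f.map_smul (op (TrivSqZeroExt.inl c.unop)) x

theorem modB_indecomp {M : Mdl Cᵐᵒᵖ} (h : Indecomp Cᵐᵒᵖ M) : Indecomp _ (modB C E M) := by
  refine ⟨h.1, fun U V hUV => ?_⟩
  have h1 := h.2 (modBSub M U) (modBSub M V) (((modBSub M).isCompl_iff).mp hUV)
  rcases h1 with h1 | h1
  · left; exact (modBSub M).injective (h1.trans (map_bot _).symm)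
  · right; exact (modBSub M).injective (h1.trans (map_bot _).symm)

theorem modB_simple (M : Mdl Cᵐᵒᵖ) : IsSimpleModule (TrivSqZeroExt C E)ᵐᵒᵖ (modB C E M) ↔ IsSimpleModule Cᵐᵒᵖ M := by
  rw [isSimpleModule_iff, isSimpleModule_iff]
  exact (modBSub M).isSimpleOrder_iff

theorem modB_gen {M N : Mdl Cᵐᵒᵖ} (h : MemGen Cᵐᵒᵖ M N) : MemGen _ (modB C E M) (modB C E N) := by
  obtain ⟨d, f, hf⟩ := h
  refine ⟨d, { toFun := fun x => f x, map_add' := fun x y => f.map_add x y, map_smul' := ?_ }, hf⟩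
  exact fun c x => f.map_smul (op c.unop.fst) x

theorem modB_finite (M : Mdl Cᵐᵒᵖ) [Module.Finite Cᵐᵒᵖ M] :
    Module.Finite (TrivSqZeroExt C E)ᵐᵒᵖ (modB C E M) := by
  obtain ⟨n, s, hs⟩ := Module.Finite.exists_fin (R := Cᵐᵒᵖ) (M := M)
  let s' : Fin n → modB C E M := s
  apply Module.Finite.of_surjective (Fintype.linearCombination (TrivSqZeroExt C E)ᵐᵒᵖ s')
  intro x
  have hx : (show M from x) ∈ Submodule.span Cᵐᵒᵖ (Set.range s) := by rw [hs]; trivial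
  rw [Submodule.mem_span_range_iff_exists_fun] at hx
  obtain ⟨c, hc⟩ := hx
  refine ⟨fun l => op (TrivSqZeroExt.inl (c l).unop), ?_⟩
  rw [Fintype.linearCombination_apply]
  exact hc

theorem simple_inr (X : Mdl (TrivSqZeroExt C E)ᵐᵒᵖ) (hX : IsSimpleModule (TrivSqZeroExt C E)ᵐᵒᵖ X) (e : E) (x : X) :
    op (TrivSqZeroExt.inr e : TrivSqZeroExt C E) • x = 0 := by
  let U : Submodule (TrivSqZeroExt C E)ᵐᵒᵖ X :=
    { carrier := {x | ∀ e : E, op (TrivSqZeroExt.inr e : TrivSqZeroExt C E) • x = 0}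
      zero_mem' := fun e => smul_zero _
      add_mem' := fun {a b} ha hb e => by rw [smul_add, ha e, hb e, add_zero]
      smul_mem' := fun c x hx e => by
        obtain ⟨c⟩ := c
        have h1 : c * TrivSqZeroExt.inr e = TrivSqZeroExt.inr (c.fst • e) := by
          ext <;> simp
        change op (TrivSqZeroExt.inr e : TrivSqZeroExt C E) • op c • x = 0
        rw [smul_smul, ← MulOpposite.op_mul, h1]
        exact hx _ }
  have hmem : ∀ (e : E) (x : X), op (TrivSqZeroExt.inr e : TrivSqZeroExt C E) • x ∈ U := by
    intro e x e'
    rw [smul_smul, ← MulOpposite.op_mul, TrivSqZeroExt.inr_mul_inr, MulOpposite.op_zero, zero_smul]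
  rcases eq_bot_or_eq_top U with h | h
  · have := hmem e x
    rw [h] at this
    exact this
  · have : x ∈ U := by rw [h]; trivial
    exact this e

theorem modB_simpleCount {n : ℕ} (h : SimpleCount Cᵐᵒᵖ n) : SimpleCount (TrivSqZeroExt C E)ᵐᵒᵖ n := by
  obtain ⟨S, hS, hiso, hall⟩ := h
  refine ⟨fun i => modB C E (S i), fun i => (modB_simple _).mpr (hS i), fun i j ⟨e⟩ => hiso i j ⟨unmodBEquiv e⟩, ?_⟩
  intro X hX
  let X' : Mdl Cᵐᵒᵖ := modAlong (tszeInl C E) X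
  let ε : X ≃ₗ[(TrivSqZeroExt C E)ᵐᵒᵖ] modB C E X' :=
    { toFun := fun x => x
      invFun := fun x => x
      left_inv := fun x => rfl
      right_inv := fun x => rfl
      map_add' := fun x y => rfl
      map_smul' := fun b x => by
        obtain ⟨b⟩ := b
        change op b • x = op (TrivSqZeroExt.inl b.fst : TrivSqZeroExt C E) • x
        conv_lhs => rw [← TrivSqZeroExt.inl_fst_add_inr_snd_eq b, MulOpposite.op_add, add_smul, simple_inr X hX, add_zero] }
  have hX' : IsSimpleModule Cᵐᵒᵖ X' := by
    rw [← modB_simple (E := E)]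
    exact IsSimpleModule.congr ε.symm
  obtain ⟨i, ⟨f⟩⟩ := hall X' hX'
  exact ⟨i, ⟨ε.trans (modBEquiv f)⟩⟩

end Asm

theorem main_aux
    (k : Type) [Field k] (C : Type) [Ring C] [Algebra k C] [FiniteDimensional k C]
    (E : Type) [AddCommGroup E] [Module C E] [Module Cᵐᵒᵖ E] [SMulCommClass C Cᵐᵒᵖ E]
    [Module k E] [IsScalarTower k C E] [IsScalarTower k Cᵐᵒᵖ E]
    (A : Type) [Ring A] [Algebra k A] [FiniteDimensional k A]
    (hhered : ∀ N : Mdl Aᵐᵒᵖ, PdLE1 Aᵐᵒᵖ N)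
    (T : Mdl Aᵐᵒᵖ) [Module.Finite Aᵐᵒᵖ T] (hT : IsTilting Aᵐᵒᵖ T)
    (hC : Nonempty (C ≃+* Module.End Aᵐᵒᵖ T))
    (hE : IsRelExt k C E)
    (M : Mdl Cᵐᵒᵖ) [Module.Finite Cᵐᵒᵖ M]
    (htau : TauTilting k C M) :
    TauTilting k (TrivSqZeroExt C E) (modB C E M) ↔ IdLE1 Cᵐᵒᵖ M := by
  obtain ⟨ε⟩ := hC
  have : IsArtinianRing Cᵐᵒᵖ := isArtinianRing_op k C
  obtain ⟨DC, hDC, P2, P1, P0, d2, d1, d0, hp2, hp1, hp0, hf2, hf1, hf0, hd2, hd0, hd21, hd10, q, hq, hq0⟩ :=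
    relExt_fg k hE
  have hEC : Module.Finite C E := relExt_finite q hq
  have hEk : Module.Finite k E := Module.Finite.trans C E
  have hEop : Module.Finite Cᵐᵒᵖ E := Module.Finite.of_restrictScalars_finite k Cᵐᵒᵖ E
  have hB : FiniteDimensional k (TrivSqZeroExt C E) := inferInstanceAs (Module.Finite k (C × E))
  have hMB : Module.Finite (TrivSqZeroExt C E)ᵐᵒᵖ (modB C E M) := modB_finite M
  constructor
  · intro h
    have hext : Ext1Fac d2 M := by
      refine ext1Fac_of_balanced d2 q hq (fun g hg => (hq0 g).mp hg) ?_
      intro V _ β h1 h2 h3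
      refine balanced_zero_of_gen k M htau ?_ V β h1 h2 h3
      intro N hN β
      exact balanced_zero_of_ext1Zero_B M N (ext1Zero_of_tauRigid k _ _ h.1 _ (modB_gen hN)) β
    exact idLE1_of_ext2 k (fun m n Φ => ker_projective hhered T hT.1.2 ε Φ) hDC d2 d1 d0 hd0 hd21 hd10 M hext
  · intro h
    have hext : Ext1Fac d2 M := ext2_of_idLE1 h d2 d1 hd2 hd21
    refine ⟨?_, ?_⟩
    · apply tauRigid_of_gen k
      intro N hN
      refine ext1Zero_B M ?_ (fun N hN => ext1Zero_of_tauRigid k C M htau.1 N hN) N hN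
      intro V _ β h1 h2 h3
      exact balancedPairing_zero d2 q hq (fun f => (hq0 _).mpr ⟨f, rfl⟩) hext β h1 h2 h3
    · obtain ⟨-, n, N, hN, hiso, ⟨e⟩, hcount⟩ := htau
      refine ⟨n, fun i => modB C E (N i), fun i => modB_indecomp (hN i), fun i j ⟨f⟩ => hiso i j ⟨unmodBEquiv f⟩,
        ⟨?_⟩, modB_simpleCount hcount⟩
      exact { toFun := fun x => e x
              invFun := fun x => e.symm x
              left_inv := e.left_inv
              right_inv := e.right_inv
              map_add' := fun x y => e.map_add x y
              map_smul' := fun c x => e.map_smul (op c.unop.fst) x }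

/-- For a tilted algebra `C` with cluster-tilted algebra `B`: a `τ_C`-tilting
module `M` is `τ_B`-tilting iff `id_C M ≤ 1`. -/
theorem tauC_tilting_tauB_tilting_iff
    (k : Type) [Field k] (C : Type) [Ring C] [Algebra k C] [FiniteDimensional k C]
    (E : Type) [AddCommGroup E] [Module C E] [Module Cᵐᵒᵖ E] [SMulCommClass C Cᵐᵒᵖ E]
    [Module k E] [IsScalarTower k C E] [IsScalarTower k Cᵐᵒᵖ E]
    (A : Type) [Ring A] [Algebra k A] [FiniteDimensional k A]
    (hhered : ∀ N : Mdl Aᵐᵒᵖ, PdLE1 Aᵐᵒᵖ N)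
    (T : Mdl Aᵐᵒᵖ) [Module.Finite Aᵐᵒᵖ T] (hT : IsTilting Aᵐᵒᵖ T)
    (hC : Nonempty (C ≃+* Module.End Aᵐᵒᵖ T))
    (hE : IsRelExt k C E)
    (M : Mdl Cᵐᵒᵖ) [Module.Finite Cᵐᵒᵖ M]
    (htau : TauTilting k C M) :
    TauTilting k (TrivSqZeroExt C E) (modB C E M) ↔ IdLE1 Cᵐᵒᵖ M := by
  exact main_aux k C E A hhered T hT hC hE M htau
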